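/- Let W_n be the number of white balls at time n in a large-index urn (model M or model R) with 1/2 < Λ < 1, let 𝒲_n := g_n(W_n − E[W_n]) with almost sure limit 𝒲_∞, and let α = ((1−Λ)/(QΛ))·√(m(2Λ−1)/(a_m b_0)). Then, almost surely, limsup_{n→∞} α·n^{Λ−1/2}·(𝒲_n − 𝒲_∞)/√(2 log log n) = 1 and liminf_{n→∞} α·n^{Λ−1/2}·(𝒲_n − 𝒲_∞)/√(2 log log n) = −1. -/

import Mathlib

open MeasureTheory ProbabilityTheory Filter Set Topology

noncomputable section

/-- Probability of drawing `k` white balls in a sample of size `m` from an urn with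
`w` white and `b` black balls, drawing *without* replacement (model M). -/
def sampleProbM (m k w b : ℕ) : ℝ :=
  (Nat.choose w k * Nat.choose b (m - k) : ℝ) / (Nat.choose (w + b) m : ℝ)

/-- Probability of drawing `k` white balls in a sample of size `m` from an urn with
`w` white and `b` black balls, drawing *with* replacement (model R). -/
def sampleProbR (m k w b : ℕ) : ℝ :=
  (Nat.choose m k : ℝ) * (w : ℝ) ^ k * (b : ℝ) ^ (m - k) / ((w : ℝ) + (b : ℝ)) ^ m

/-- A balanced affine tenable two-color urn scheme with multiple drawings.
`mdlM = true` is model M (sampling without replacement), `mdlM = false` is model R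
(sampling with replacement).  `W n`, `B n` are the numbers of white and black balls
after `n` draws (ℕ-valued, which encodes tenability), `R (n+1)` is the number of white
balls in the `(n+1)`-st sample, and `F` is the filtration generated by the draws. -/
structure UrnScheme {Ω : Type*} [m0 : MeasurableSpace Ω] (μ : Measure Ω)
    (mdlM : Bool) (m : ℕ) (a b : ℕ → ℤ) (σ : ℤ) (W0 B0 : ℕ)
    (W B : ℕ → Ω → ℕ) (R : ℕ → Ω → ℕ) (F : Filtration ℕ m0) : Prop where
  hm : 1 ≤ m
  hσ : 1 ≤ σ
  balanced : ∀ k ≤ m, a k + b k = σ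
  affine : ∀ k ≤ m, a k = ((m : ℤ) - (k : ℤ)) * (a (m - 1) - a m) + a m
  initW : ∀ ω, W 0 ω = W0
  initB : ∀ ω, B 0 ω = B0
  sampleLe : ∀ n ω, R (n + 1) ω ≤ m
  sampleFit : ∀ n ω, (if mdlM then m else 1) ≤ W n ω + B n ω
  dynW : ∀ n ω, (W (n + 1) ω : ℤ) = (W n ω : ℤ) + a (m - R (n + 1) ω)
  dynB : ∀ n ω, (B (n + 1) ω : ℤ) = (B n ω : ℤ) + b (m - R (n + 1) ω)
  measW : ∀ n, Measurable[F n] (W n)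
  measB : ∀ n, Measurable[F n] (B n)
  measR : ∀ n, Measurable[F (n + 1)] (R (n + 1))
  condLaw : ∀ n, ∀ k ≤ m,
      (μ[(({ω | R (n + 1) ω = k}).indicator fun _ => (1 : ℝ)) | F n])
        =ᵐ[μ] fun ω =>
          if mdlM then sampleProbM m k (W n ω) (B n ω)
          else sampleProbR m k (W n ω) (B n ω)

/-- The urn index `Λ = m (a_{m-1} - a_m) / σ`. -/
def urnIndex (m : ℕ) (a : ℕ → ℤ) (σ : ℤ) : ℝ :=
  (m : ℝ) * ((a (m - 1) : ℝ) - (a m : ℝ)) / (σ : ℝ)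

/-- `ζ = a_m / (1 - Λ)`. -/
def urnZeta (m : ℕ) (a : ℕ → ℤ) (σ : ℤ) : ℝ :=
  (a m : ℝ) / (1 - urnIndex m a σ)

/-- `Q = Γ(T₀/σ + Λ) / Γ(T₀/σ)`. -/
def urnQ (T0 : ℕ) (σ : ℤ) (Λ : ℝ) : ℝ :=
  Real.Gamma ((T0 : ℝ) / (σ : ℝ) + Λ) / Real.Gamma ((T0 : ℝ) / (σ : ℝ))

/-- `g_n = Q · Γ(n + T₀/σ) / Γ(n + T₀/σ + Λ)`. -/
def urnG (T0 : ℕ) (σ : ℤ) (Λ : ℝ) (n : ℕ) : ℝ :=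
  urnQ T0 σ Λ * Real.Gamma ((n : ℝ) + (T0 : ℝ) / (σ : ℝ)) /
    Real.Gamma ((n : ℝ) + (T0 : ℝ) / (σ : ℝ) + Λ)

/-- Convergence in distribution of the sequence `X n` (on `(Ω, μ)`) to the law `ν`,
i.e. weak convergence of the image measures. -/
def TendstoInDistribution {Ω : Type*} [MeasurableSpace Ω] (μ : Measure Ω)
    (X : ℕ → Ω → ℝ) (ν : Measure ℝ) : Prop :=
  ∀ f : BoundedContinuousFunction ℝ ℝ,
    Tendsto (fun n => ∫ ω, f (X n ω) ∂μ) atTop (𝓝 (∫ x, f x ∂ν))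

/-- The martingale `𝒲_n = g_n (W_n - E[W_n])` for large-index urns. -/
def calW {Ω : Type*} [MeasurableSpace Ω] (μ : Measure Ω) (σ : ℤ) (Λ : ℝ) (T0 : ℕ)
    (W : ℕ → Ω → ℕ) (n : ℕ) (ω : Ω) : ℝ :=
  urnG T0 σ Λ n * ((W n ω : ℝ) - ∫ ω', (W n ω' : ℝ) ∂μ)

/-- The scaling constant `α = ((1-Λ)/(QΛ)) √(m(2Λ-1)/(a_m b_0))`. -/
def alphaConst (m : ℕ) (a b : ℕ → ℤ) (σ : ℤ) (T0 : ℕ) : ℝ :=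
  (1 - urnIndex m a σ) / (urnQ T0 σ (urnIndex m a σ) * urnIndex m a σ) *
    Real.sqrt ((m : ℝ) * (2 * urnIndex m a σ - 1) / ((a m : ℝ) * (b 0 : ℝ)))

/-- The variance `n ^ (-2β)` of the tail after time `n`. -/
def tailVar (β : ℝ) (n : ℕ) : ℝ := (n : ℝ) ^ (-(2 * β))

/-- The normalisation `n ^ (-β) * √(2 log log n)` in the law of the iterated logarithm. -/
def iterLogScale (β : ℝ) (n : ℕ) : ℝ :=
  (n : ℝ) ^ (-β) * Real.sqrt (2 * Real.log (Real.log n))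

/-- Martingale increments `D k` (from time `k` to time `k + 1`, for `k ≥ K`) that are bounded by
`C * k ^ (-(1/2 + β))` and have conditional variance at most
`A * (tailVar β k - tailVar β (k + 1))`. The conditional moments are tested against bounded
functions measurable with respect to `F k`. -/
structure TailIncrements {Ω : Type*} [m0 : MeasurableSpace Ω] (μ : Measure Ω)
    (F : Filtration ℕ m0) (β A C : ℝ) (K : ℕ) (D : ℕ → Ω → ℝ) : Prop where
  one_le : 1 ≤ K
  meas : ∀ k ≥ K, Measurable[F (k + 1)] (D k)
  bdd : ∀ k ≥ K, ∀ ω, |D k ω| ≤ C * (k : ℝ) ^ (-(1 / 2 + β))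
  mean : ∀ k ≥ K, ∀ f : Ω → ℝ, Measurable[F k] f → (∃ b, ∀ ω, |f ω| ≤ b) →
    ∫ ω, f ω * D k ω ∂μ = 0
  var : ∀ k ≥ K, ∀ f : Ω → ℝ, Measurable[F k] f → (∃ b, ∀ ω, |f ω| ≤ b) → (∀ ω, 0 ≤ f ω) →
    ∫ ω, f ω * D k ω ^ 2 ∂μ ≤ A * (tailVar β k - tailVar β (k + 1)) * ∫ ω, f ω ∂μ

lemma exp_quadratic_bounds {y ρ : ℝ} (hy : |y| ≤ ρ) (hρ : ρ ≤ 1) :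
    1 + y + (1 - ρ) / 2 * y ^ 2 ≤ Real.exp y ∧ Real.exp y ≤ 1 + y + (1 + ρ) / 2 * y ^ 2 := by
  have h := Real.exp_bound (hy.trans hρ) (n := 3) (by norm_num)
  norm_num [Finset.sum_range_succ, Nat.factorial] at h
  have h1 : |y| ^ 3 ≤ ρ * y ^ 2 := by
    rw [pow_succ, sq_abs, mul_comm]
    exact mul_le_mul_of_nonneg_right hy (sq_nonneg y)
  have h0 : 0 ≤ |y| ^ 3 := by positivity
  rw [abs_le] at h
  constructor <;> nlinarith [h.1, h.2]

lemma exp_sub_sq_le_one_add {u : ℝ} (h0 : 0 ≤ u) (h1 : u ≤ 1) :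
    Real.exp (u - u ^ 2) ≤ 1 + u := by
  have ht0 : 0 ≤ u - u ^ 2 := by nlinarith
  have ht1 : u - u ^ 2 ≤ 1 := by nlinarith
  have h := Real.abs_exp_sub_one_sub_id_le (x := u - u ^ 2) (by rw [abs_of_nonneg ht0]; exact ht1)
  rw [abs_le] at h
  have : (u - u ^ 2) ^ 2 ≤ u ^ 2 := by
    apply pow_le_pow_left₀ ht0; nlinarith
  linarith [h.2]

lemma integrable_of_abs_le {Ω : Type*} [MeasurableSpace Ω] {μ : Measure Ω} [IsFiniteMeasure μ]
    {f : Ω → ℝ} (hf : Measurable f) {b : ℝ} (hb : ∀ ω, |f ω| ≤ b) : Integrable f μ :=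
  Integrable.of_bound hf.aestronglyMeasurable b (ae_of_all _ hb)

lemma rpow_neg_antitone {n k : ℕ} (hn : 1 ≤ n) (hk : n ≤ k) {p : ℝ} (hp : 0 ≤ p) :
    (k : ℝ) ^ (-p) ≤ (n : ℝ) ^ (-p) :=
  Real.rpow_le_rpow_of_nonpos (by exact_mod_cast hn) (by exact_mod_cast hk) (by linarith)

lemma tailVar_antitone {β : ℝ} (hβ : 0 < β) {n k : ℕ} (hn : 1 ≤ n) (hk : n ≤ k) :
    tailVar β k ≤ tailVar β n :=
  rpow_neg_antitone hn hk (by positivity)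

namespace TailIncrements

variable {Ω : Type*} [m0 : MeasurableSpace Ω] {μ : Measure Ω}
  {F : Filtration ℕ m0} {β A C : ℝ} {K : ℕ} {D : ℕ → Ω → ℝ}

lemma neg (h : TailIncrements μ F β A C K D) :
    TailIncrements μ F β A C K (fun k ω => -D k ω) where
  one_le := h.one_le
  meas k hk := (h.meas k hk).neg
  bdd k hk ω := by simpa using h.bdd k hk ω
  mean k hk f hf hb := by
    simpa [integral_neg] using h.mean k hk f hf hb
  var k hk f hf hb h0 := by simpa using h.var k hk f hf hb h0

lemma measurable (h : TailIncrements μ F β A C K D) {k : ℕ} (hk : K ≤ k) : Measurable (D k) :=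
  (h.meas k hk).mono (F.le _) le_rfl

lemma measurable_sum (h : TailIncrements μ F β A C K D) {n : ℕ} (hn : K ≤ n) (i : ℕ) :
    Measurable[F (n + i)] (fun ω => ∑ k ∈ Finset.Ico n (n + i), D k ω) := by
  refine Finset.measurable_fun_sum _ fun k hk => ?_
  rw [Finset.mem_Ico] at hk
  exact (h.meas k (hn.trans hk.1)).mono (F.mono (by omega)) le_rfl

variable [IsProbabilityMeasure μ]

lemma C_nonneg (h : TailIncrements μ F β A C K D) : 0 ≤ C := by
  obtain ⟨ω⟩ : Nonempty Ω := nonempty_of_isProbabilityMeasure μ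
  have h1 := (abs_nonneg _).trans (h.bdd K le_rfl ω)
  have h2 : (0 : ℝ) < (K : ℝ) ^ (-(1 / 2 + β)) :=
    Real.rpow_pos_of_pos (by exact_mod_cast h.one_le) _
  exact nonneg_of_mul_nonneg_left h1 h2

lemma abs_le_of_le (h : TailIncrements μ F β A C K D) (hβ : 0 < β) {n k : ℕ} (hn : K ≤ n)
    (hk : n ≤ k) (ω : Ω) : |D k ω| ≤ C * (n : ℝ) ^ (-(1 / 2 + β)) :=
  (h.bdd k (hn.trans hk) ω).trans
    (mul_le_mul_of_nonneg_left (rpow_neg_antitone (h.one_le.trans hn) hk (by positivity))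
      h.C_nonneg)

/-- The three integrals entering the one-step exponential estimates. -/
lemma integral_quadratic (h : TailIncrements μ F β A C K D) {k : ℕ} (hk : K ≤ k) {f : Ω → ℝ}
    (hf : Measurable[F k] f) (hb : ∃ b, ∀ ω, |f ω| ≤ b) (l c : ℝ) :
    Integrable (fun ω => f ω * (1 + l * D k ω + c * (l * D k ω) ^ 2)) μ ∧
    ∫ ω, f ω * (1 + l * D k ω + c * (l * D k ω) ^ 2) ∂μ =
      ∫ ω, f ω ∂μ + c * l ^ 2 * ∫ ω, f ω * D k ω ^ 2 ∂μ := by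
  obtain ⟨b, hb'⟩ := id hb
  have hfm : Measurable f := hf.mono (F.le _) le_rfl
  have hD := h.measurable hk
  have hb0 : ∀ ω, 0 ≤ b := fun ω => (abs_nonneg _).trans (hb' ω)
  have i0 : Integrable f μ := integrable_of_abs_le hfm hb'
  have i1 : Integrable (fun ω => f ω * D k ω) μ := by
    refine integrable_of_abs_le (hfm.mul hD) (b := b * (C * (k : ℝ) ^ (-(1 / 2 + β))))
      fun ω => ?_
    rw [abs_mul]
    exact mul_le_mul (hb' ω) (h.bdd k hk ω) (abs_nonneg _) (hb0 ω)
  have i2 : Integrable (fun ω => f ω * D k ω ^ 2) μ := by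
    refine integrable_of_abs_le (hfm.mul (hD.pow_const 2))
      (b := b * (C * (k : ℝ) ^ (-(1 / 2 + β))) ^ 2) fun ω => ?_
    rw [abs_mul, abs_pow]
    exact mul_le_mul (hb' ω) (pow_le_pow_left₀ (abs_nonneg _) (h.bdd k hk ω) 2)
      (by positivity) (hb0 ω)
  have he : (fun ω => f ω * (1 + l * D k ω + c * (l * D k ω) ^ 2)) =
      fun ω => f ω + l * (f ω * D k ω) + c * l ^ 2 * (f ω * D k ω ^ 2) := by
    funext ω; ring
  rw [he]
  refine ⟨(i0.add (i1.const_mul l)).add (i2.const_mul _), ?_⟩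
  have i01 : Integrable (fun ω => f ω + l * (f ω * D k ω)) μ := i0.add (i1.const_mul l)
  rw [integral_add i01 (i2.const_mul _), integral_add i0 (i1.const_mul l),
    integral_const_mul, integral_const_mul, h.mean k hk f hf hb]
  ring

lemma integrable_mul_exp (h : TailIncrements μ F β A C K D) {k : ℕ} (hk : K ≤ k) {f : Ω → ℝ}
    (hf : Measurable[F k] f) (hb : ∃ b, ∀ ω, |f ω| ≤ b) (l : ℝ) :
    Integrable (fun ω => f ω * Real.exp (l * D k ω)) μ := by
  obtain ⟨b, hb⟩ := hb
  have hfm : Measurable f := hf.mono (F.le _) le_rfl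
  refine integrable_of_abs_le (hfm.mul ((h.measurable hk).const_mul l).exp)
    (b := b * Real.exp (|l| * (C * (k : ℝ) ^ (-(1 / 2 + β))))) fun ω => ?_
  rw [abs_mul, Real.abs_exp]
  refine mul_le_mul (hb ω) (Real.exp_le_exp.2 ?_) (Real.exp_pos _).le
    ((abs_nonneg _).trans (hb ω))
  refine (le_abs_self _).trans ?_
  rw [abs_mul]
  exact mul_le_mul_of_nonneg_left (h.bdd k hk ω) (abs_nonneg _)

lemma le_integral_mul_exp (h : TailIncrements μ F β A C K D) {k : ℕ} (hk : K ≤ k) {f : Ω → ℝ}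
    (hf : Measurable[F k] f) (hb : ∃ b, ∀ ω, |f ω| ≤ b) (h0 : ∀ ω, 0 ≤ f ω) (l : ℝ) :
    ∫ ω, f ω ∂μ ≤ ∫ ω, f ω * Real.exp (l * D k ω) ∂μ := by
  obtain ⟨hi, he⟩ := h.integral_quadratic hk hf hb l 0
  rw [zero_mul, zero_mul, add_zero] at he
  rw [← he]
  refine integral_mono hi (h.integrable_mul_exp hk hf hb l) fun ω => ?_
  refine mul_le_mul_of_nonneg_left ?_ (h0 ω)
  linarith [Real.add_one_le_exp (l * D k ω)]

lemma integral_mul_exp_le (h : TailIncrements μ F β A C K D) {k : ℕ} (hk : K ≤ k) {f : Ω → ℝ}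
    (hf : Measurable[F k] f) (hb : ∃ b, ∀ ω, |f ω| ≤ b) (h0 : ∀ ω, 0 ≤ f ω) {l ρ : ℝ}
    (hρ : ρ ≤ 1) (hl : ∀ ω, |l * D k ω| ≤ ρ) :
    ∫ ω, f ω * Real.exp (l * D k ω) ∂μ ≤
      Real.exp ((1 + ρ) / 2 * l ^ 2 * (A * (tailVar β k - tailVar β (k + 1)))) *
        ∫ ω, f ω ∂μ := by
  obtain ⟨ω₀⟩ : Nonempty Ω := nonempty_of_isProbabilityMeasure μ
  have hρ0 : 0 ≤ ρ := (abs_nonneg _).trans (hl ω₀)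
  obtain ⟨hi, he⟩ := h.integral_quadratic hk hf hb l ((1 + ρ) / 2)
  have hI : 0 ≤ ∫ ω, f ω ∂μ := integral_nonneg h0
  calc ∫ ω, f ω * Real.exp (l * D k ω) ∂μ
      ≤ ∫ ω, f ω * (1 + l * D k ω + (1 + ρ) / 2 * (l * D k ω) ^ 2) ∂μ :=
        integral_mono (h.integrable_mul_exp hk hf hb l) hi fun ω =>
          mul_le_mul_of_nonneg_left (exp_quadratic_bounds (hl ω) hρ).2 (h0 ω)
    _ = ∫ ω, f ω ∂μ + (1 + ρ) / 2 * l ^ 2 * ∫ ω, f ω * D k ω ^ 2 ∂μ := he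
    _ ≤ ∫ ω, f ω ∂μ + (1 + ρ) / 2 * l ^ 2 *
          (A * (tailVar β k - tailVar β (k + 1)) * ∫ ω, f ω ∂μ) := by
        have := mul_le_mul_of_nonneg_left (h.var k hk f hf hb h0)
          (by positivity : 0 ≤ (1 + ρ) / 2 * l ^ 2)
        linarith
    _ = ((1 + ρ) / 2 * l ^ 2 * (A * (tailVar β k - tailVar β (k + 1))) + 1) *
          ∫ ω, f ω ∂μ := by ring
    _ ≤ _ := mul_le_mul_of_nonneg_right (Real.add_one_le_exp _) hI

lemma le_integral_mul_exp_of_var_eq (h : TailIncrements μ F β A C K D)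
    (hv : ∀ k ≥ K, ∀ f : Ω → ℝ, Measurable[F k] f → (∃ b, ∀ ω, |f ω| ≤ b) →
      ∫ ω, f ω * D k ω ^ 2 ∂μ = (tailVar β k - tailVar β (k + 1)) * ∫ ω, f ω ∂μ)
    (hβ : 0 < β) {k : ℕ} (hk : K ≤ k) {f : Ω → ℝ}
    (hf : Measurable[F k] f) (hb : ∃ b, ∀ ω, |f ω| ≤ b) (h0 : ∀ ω, 0 ≤ f ω) {l ρ : ℝ}
    (hρ : ρ ≤ 1) (hl : ∀ ω, |l * D k ω| ≤ ρ) :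
    Real.exp ((1 - 2 * ρ) / 2 * l ^ 2 * (tailVar β k - tailVar β (k + 1))) * ∫ ω, f ω ∂μ ≤
      ∫ ω, f ω * Real.exp (l * D k ω) ∂μ := by
  obtain ⟨ω₀⟩ : Nonempty Ω := nonempty_of_isProbabilityMeasure μ
  have hρ0 : 0 ≤ ρ := (abs_nonneg _).trans (hl ω₀)
  obtain ⟨hi, he⟩ := h.integral_quadratic hk hf hb l ((1 - ρ) / 2)
  have hI : 0 ≤ ∫ ω, f ω ∂μ := integral_nonneg h0
  set ψ := tailVar β k - tailVar β (k + 1) with hψ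
  have hψ0 : 0 ≤ ψ := sub_nonneg.2 (tailVar_antitone hβ (h.one_le.trans hk) (Nat.le_succ k))
  have hlψ : l ^ 2 * ψ ≤ ρ ^ 2 := by
    have e1 := hv k hk (fun _ => 1) measurable_const ⟨1, fun _ => by simp⟩
    simp only [one_mul, integral_const, probReal_univ, smul_eq_mul, mul_one] at e1
    rw [← hψ] at e1
    rw [← e1, ← integral_const_mul]
    calc ∫ ω, l ^ 2 * D k ω ^ 2 ∂μ ≤ ∫ ω, ρ ^ 2 ∂μ := by
          refine integral_mono_of_nonneg (ae_of_all _ fun ω => by positivity)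
            (integrable_const _) (ae_of_all _ fun ω => ?_)
          have := pow_le_pow_left₀ (abs_nonneg _) (hl ω) 2
          rw [sq_abs, mul_pow] at this
          exact this
      _ = ρ ^ 2 := by simp
  set u := (1 - ρ) / 2 * (l ^ 2 * ψ) with hu
  have hlψ0 : 0 ≤ l ^ 2 * ψ := by positivity
  have hu0 : 0 ≤ u := mul_nonneg (by linarith) hlψ0
  have hρ2 : ρ ^ 2 ≤ ρ := by nlinarith
  have hu1 : u ≤ ρ / 2 := by nlinarith
  have hexp : (1 - 2 * ρ) / 2 * l ^ 2 * ψ ≤ u - u ^ 2 := by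
    have h1 : u ^ 2 ≤ ρ / 2 * u := by nlinarith
    have h2 : u ≤ (l ^ 2 * ψ) / 2 := by nlinarith
    have h3 : ρ / 2 * u ≤ ρ / 2 * ((l ^ 2 * ψ) / 2) :=
      mul_le_mul_of_nonneg_left h2 (by linarith)
    have h4 : 0 ≤ ρ * (l ^ 2 * ψ) := mul_nonneg hρ0 hlψ0
    nlinarith
  calc Real.exp ((1 - 2 * ρ) / 2 * l ^ 2 * ψ) * ∫ ω, f ω ∂μ
      ≤ (1 + u) * ∫ ω, f ω ∂μ := mul_le_mul_of_nonneg_right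
        ((Real.exp_le_exp.2 hexp).trans (exp_sub_sq_le_one_add hu0 (by linarith))) hI
    _ = ∫ ω, f ω * (1 + l * D k ω + (1 - ρ) / 2 * (l * D k ω) ^ 2) ∂μ := by
        rw [he, hv k hk f hf hb, hu]; ring
    _ ≤ _ := integral_mono hi (h.integrable_mul_exp hk hf hb l) fun ω =>
          mul_le_mul_of_nonneg_left (exp_quadratic_bounds (hl ω) hρ).1 (h0 ω)

lemma abs_sum_le (h : TailIncrements μ F β A C K D) (hβ : 0 < β) {n : ℕ} (hn : K ≤ n) (i : ℕ)
    (ω : Ω) : |∑ k ∈ Finset.Ico n (n + i), D k ω| ≤ i * (C * (n : ℝ) ^ (-(1 / 2 + β))) := by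
  refine (Finset.abs_sum_le_sum_abs _ _).trans ?_
  refine (Finset.sum_le_card_nsmul _ _ _ fun k hk =>
    h.abs_le_of_le hβ hn (Finset.mem_Ico.1 hk).1 ω).trans ?_
  simp

/-- `f * exp (l * S)`, with `S` a partial sum of the increments, is again a test function. -/
lemma mul_exp_sum_bdd (h : TailIncrements μ F β A C K D) (hβ : 0 < β) {n : ℕ} (hn : K ≤ n)
    {f : Ω → ℝ} (hf : Measurable[F n] f) (hb : ∃ b, ∀ ω, |f ω| ≤ b) (l : ℝ) (i : ℕ) :
    Measurable[F (n + i)]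
      (fun ω => f ω * Real.exp (l * ∑ k ∈ Finset.Ico n (n + i), D k ω)) ∧
    ∃ b, ∀ ω, |f ω * Real.exp (l * ∑ k ∈ Finset.Ico n (n + i), D k ω)| ≤ b := by
  constructor
  · exact (hf.mono (F.mono (by omega)) le_rfl).mul ((h.measurable_sum hn i).const_mul l).exp
  · obtain ⟨b, hb⟩ := hb
    refine ⟨b * Real.exp (|l| * (i * (C * (n : ℝ) ^ (-(1 / 2 + β))))), fun ω => ?_⟩
    rw [abs_mul, Real.abs_exp]
    refine mul_le_mul (hb ω) (Real.exp_le_exp.2 ?_) (Real.exp_pos _).le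
      ((abs_nonneg _).trans (hb ω))
    refine (le_abs_self _).trans ?_
    rw [abs_mul]
    exact mul_le_mul_of_nonneg_left (h.abs_sum_le hβ hn i ω) (abs_nonneg _)

lemma integral_mul_exp_sum_le (h : TailIncrements μ F β A C K D) (hβ : 0 < β) {n : ℕ}
    (hn : K ≤ n) {f : Ω → ℝ} (hf : Measurable[F n] f) (hb : ∃ b, ∀ ω, |f ω| ≤ b)
    (h0 : ∀ ω, 0 ≤ f ω) {l ρ : ℝ} (hρ : ρ ≤ 1)
    (hl : |l| * (C * (n : ℝ) ^ (-(1 / 2 + β))) ≤ ρ) (i : ℕ) :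
    ∫ ω, f ω * Real.exp (l * ∑ k ∈ Finset.Ico n (n + i), D k ω) ∂μ ≤
      Real.exp ((1 + ρ) / 2 * l ^ 2 * (A * (tailVar β n - tailVar β (n + i)))) *
        ∫ ω, f ω ∂μ := by
  induction i with
  | zero => simp
  | succ i ih =>
    obtain ⟨hm, hbd⟩ := h.mul_exp_sum_bdd hβ hn hf hb l i
    have hstep := h.integral_mul_exp_le (k := n + i) (by omega) hm hbd
      (fun ω => mul_nonneg (h0 ω) (Real.exp_pos _).le) (l := l) hρ (fun ω => by
        rw [abs_mul]
        exact (mul_le_mul_of_nonneg_left (h.abs_le_of_le hβ hn (by omega) ω)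
          (abs_nonneg _)).trans hl)
    calc _ = ∫ ω, f ω * Real.exp (l * ∑ k ∈ Finset.Ico n (n + i), D k ω) *
            Real.exp (l * D (n + i) ω) ∂μ := by
          congr 1; funext ω
          rw [← add_assoc, Finset.sum_Ico_succ_top (by omega), mul_add, Real.exp_add, mul_assoc]
      _ ≤ _ := hstep
      _ ≤ _ := mul_le_mul_of_nonneg_left ih (Real.exp_pos _).le
      _ = _ := by
          rw [← mul_assoc, ← Real.exp_add, ← add_assoc]
          congr 2; ring

lemma le_integral_mul_exp_sum (h : TailIncrements μ F β A C K D)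
    (hv : ∀ k ≥ K, ∀ f : Ω → ℝ, Measurable[F k] f → (∃ b, ∀ ω, |f ω| ≤ b) →
      ∫ ω, f ω * D k ω ^ 2 ∂μ = (tailVar β k - tailVar β (k + 1)) * ∫ ω, f ω ∂μ)
    (hβ : 0 < β) {n : ℕ}
    (hn : K ≤ n) {f : Ω → ℝ} (hf : Measurable[F n] f) (hb : ∃ b, ∀ ω, |f ω| ≤ b)
    (h0 : ∀ ω, 0 ≤ f ω) {l ρ : ℝ} (hρ : ρ ≤ 1)
    (hl : |l| * (C * (n : ℝ) ^ (-(1 / 2 + β))) ≤ ρ) (i : ℕ) :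
    Real.exp ((1 - 2 * ρ) / 2 * l ^ 2 * (tailVar β n - tailVar β (n + i))) * ∫ ω, f ω ∂μ ≤
      ∫ ω, f ω * Real.exp (l * ∑ k ∈ Finset.Ico n (n + i), D k ω) ∂μ := by
  induction i with
  | zero => simp
  | succ i ih =>
    obtain ⟨hm, hbd⟩ := h.mul_exp_sum_bdd hβ hn hf hb l i
    have hstep := h.le_integral_mul_exp_of_var_eq hv hβ (k := n + i) (by omega) hm hbd
      (fun ω => mul_nonneg (h0 ω) (Real.exp_pos _).le) (l := l) hρ (fun ω => by
        rw [abs_mul]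
        exact (mul_le_mul_of_nonneg_left (h.abs_le_of_le hβ hn (by omega) ω)
          (abs_nonneg _)).trans hl)
    calc _ = Real.exp ((1 - 2 * ρ) / 2 * l ^ 2 *
              (tailVar β (n + i) - tailVar β (n + i + 1))) *
            (Real.exp ((1 - 2 * ρ) / 2 * l ^ 2 * (tailVar β n - tailVar β (n + i))) *
              ∫ ω, f ω ∂μ) := by
          rw [← mul_assoc, ← Real.exp_add, ← add_assoc]
          congr 2; ring
      _ ≤ _ := mul_le_mul_of_nonneg_left ih (Real.exp_pos _).le
      _ ≤ _ := hstep
      _ = ∫ ω, f ω * Real.exp (l * ∑ k ∈ Finset.Ico n (n + (i + 1)), D k ω) ∂μ := by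
          congr 1; funext ω
          rw [← add_assoc, Finset.sum_Ico_succ_top (by omega), mul_add, Real.exp_add, mul_assoc]

/-- Doob's maximal inequality for `exp (l * S)`. -/
lemma measure_exists_le_sum_le (h : TailIncrements μ F β A C K D) (hβ : 0 < β) {n : ℕ}
    (hn : K ≤ n) {l ρ V x : ℝ} (hρ : ρ ≤ 1) (hl0 : 0 < l)
    (hl : l * (C * (n : ℝ) ^ (-(1 / 2 + β))) ≤ ρ) (I : ℕ)
    (hV : A * (tailVar β n - tailVar β (n + I)) ≤ V) :
    μ {ω | ∃ i ≤ I, x ≤ ∑ k ∈ Finset.Ico n (n + i), D k ω} ≤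
      ENNReal.ofReal (Real.exp ((1 + ρ) / 2 * l ^ 2 * V - l * x)) := by
  have hρ0 : 0 ≤ ρ := le_trans (mul_nonneg hl0.le (mul_nonneg h.C_nonneg
    (Real.rpow_nonneg (by positivity) _))) hl
  let G : Filtration ℕ m0 := ⟨fun i => F (n + i), fun i j hij => F.mono (by simpa using hij),
    fun i => F.le _⟩
  let X : ℕ → Ω → ℝ := fun i ω => Real.exp (l * ∑ k ∈ Finset.Ico n (n + i), D k ω)
  have hX := fun i => h.mul_exp_sum_bdd hβ hn (f := fun _ => 1) measurable_const
    ⟨1, fun _ => by simp⟩ l i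
  simp only [one_mul] at hX
  have hsub : Submartingale X G μ := by
    refine submartingale_of_setIntegral_le_succ (fun i => (hX i).1.stronglyMeasurable)
      (fun i => ?_) fun i s hs => ?_
    · obtain ⟨b, hb⟩ := (hX i).2
      exact integrable_of_abs_le ((hX i).1.mono (F.le _) le_rfl) hb
    · obtain ⟨b, hb⟩ := (hX i).2
      have hs' : MeasurableSet s := F.le _ _ hs
      rw [← integral_indicator hs', ← integral_indicator hs']
      have := h.le_integral_mul_exp (k := n + i) (by omega)
        (f := s.indicator (X i)) ((hX i).1.indicator hs)
        ⟨b, fun ω => by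
          by_cases hω : ω ∈ s
          · rw [indicator_of_mem hω]; exact hb ω
          · simpa [hω] using (abs_nonneg _).trans (hb ω)⟩
        (fun ω => indicator_nonneg (fun _ _ => (Real.exp_pos _).le) ω) l
      refine this.trans_eq ?_
      congr 1; funext ω
      by_cases hω : ω ∈ s
      · simp only [hω, indicator_of_mem, X]
        rw [← add_assoc, Finset.sum_Ico_succ_top (by omega), mul_add, Real.exp_add]
      · simp [hω]
  have hmax := maximal_ineq hsub (fun i ω => (Real.exp_pos _).le)
    (ε := ⟨Real.exp (l * x), (Real.exp_pos _).le⟩) I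
  have hset : {ω | ∃ i ≤ I, x ≤ ∑ k ∈ Finset.Ico n (n + i), D k ω} ⊆
      {ω | ((⟨Real.exp (l * x), (Real.exp_pos _).le⟩ : NNReal) : ℝ) ≤
        (Finset.range (I + 1)).sup' Finset.nonempty_range_add_one fun k => X k ω} := by
    rintro ω ⟨i, hi, hx⟩
    refine le_trans ?_ (Finset.le_sup' (f := fun k => X k ω)
      (Finset.mem_range.2 (Nat.lt_succ_of_le hi)))
    exact Real.exp_le_exp.2 (mul_le_mul_of_nonneg_left hx hl0.le)
  have h_int : ∫ ω, X I ω ∂μ ≤ Real.exp ((1 + ρ) / 2 * l ^ 2 * V) := by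
    have := h.integral_mul_exp_sum_le hβ hn (f := fun _ => 1) measurable_const
      ⟨1, fun _ => by simp⟩ (fun _ => zero_le_one) hρ (l := l)
      (by rwa [abs_of_pos hl0]) I
    simp only [one_mul, integral_const, probReal_univ, smul_eq_mul, mul_one] at this
    refine this.trans (Real.exp_le_exp.2 ?_)
    exact mul_le_mul_of_nonneg_left hV (by positivity)
  have hXint : Integrable (X I) μ := hsub.integrable I
  have hne : ENNReal.ofReal (Real.exp (l * x)) ≠ 0 := by
    simpa using Real.exp_pos _
  have h2 : ENNReal.ofReal (Real.exp (l * x)) *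
      μ {ω | ∃ i ≤ I, x ≤ ∑ k ∈ Finset.Ico n (n + i), D k ω} ≤
      ENNReal.ofReal (Real.exp ((1 + ρ) / 2 * l ^ 2 * V)) := by
    calc _ ≤ _ := mul_le_mul_right (measure_mono hset) _
      _ = _ := by
        congr 1
        rw [ENNReal.ofReal]
        congr 1
        exact Real.toNNReal_of_nonneg (Real.exp_pos _).le
      _ ≤ _ := hmax
      _ ≤ _ := ENNReal.ofReal_le_ofReal
        ((setIntegral_le_integral hXint (ae_of_all _ fun ω => (Real.exp_pos _).le)).trans h_int)
  rw [Real.exp_sub, ENNReal.ofReal_div_of_pos (Real.exp_pos _),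
    ENNReal.le_div_iff_mul_le (Or.inl hne) (Or.inl ENNReal.ofReal_ne_top), mul_comm]
  exact h2

/-- The maximal inequality over the whole future. -/
lemma measure_exists_le_sum_le_of_forall (h : TailIncrements μ F β A C K D) (hβ : 0 < β) {n : ℕ}
    (hn : K ≤ n) {l ρ V x : ℝ} (hρ : ρ ≤ 1) (hl0 : 0 < l)
    (hl : l * (C * (n : ℝ) ^ (-(1 / 2 + β))) ≤ ρ)
    (hV : ∀ I, A * (tailVar β n - tailVar β (n + I)) ≤ V) :
    μ {ω | ∃ i, x ≤ ∑ k ∈ Finset.Ico n (n + i), D k ω} ≤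
      ENNReal.ofReal (Real.exp ((1 + ρ) / 2 * l ^ 2 * V - l * x)) := by
  have he : {ω | ∃ i, x ≤ ∑ k ∈ Finset.Ico n (n + i), D k ω} =
      ⋃ I : ℕ, {ω | ∃ i ≤ I, x ≤ ∑ k ∈ Finset.Ico n (n + i), D k ω} := by
    ext ω
    simp only [mem_ofPred_eq, mem_iUnion]
    exact ⟨fun ⟨i, hi⟩ => ⟨i, i, le_rfl, hi⟩, fun ⟨_, i, _, hi⟩ => ⟨i, hi⟩⟩
  rw [he, Monotone.measure_iUnion]
  · exact iSup_le fun I => h.measure_exists_le_sum_le hβ hn hρ hl0 hl I (hV I)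
  · rintro I J hIJ ω ⟨i, hi, hx⟩
    exact ⟨i, hi.trans hIJ, hx⟩

end TailIncrements

lemma tendsto_log_log_natCast_atTop :
    Tendsto (fun n : ℕ => Real.log (Real.log n)) atTop atTop :=
  Real.tendsto_log_atTop.comp (Real.tendsto_log_atTop.comp tendsto_natCast_atTop_atTop)

lemma tendsto_sqrt_log_log_mul_rpow :
    Tendsto (fun n : ℕ => Real.sqrt (2 * Real.log (Real.log n)) * (n : ℝ) ^ (-(1 / 2 : ℝ)))
      atTop (𝓝 0) := by
  have h1 : Tendsto (fun x : ℝ => Real.log x / x) atTop (𝓝 0) :=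
    Real.isLittleO_log_id_atTop.tendsto_div_nhds_zero
  have hn : Tendsto (fun n : ℕ => (n : ℝ)) atTop atTop := tendsto_natCast_atTop_atTop
  have h2 := (h1.comp (Real.tendsto_log_atTop.comp hn)).mul (h1.comp hn)
  have h3 : Tendsto (fun n : ℕ => Real.sqrt (2 * (Real.log (Real.log n) / n))) atTop (𝓝 0) := by
    have : Tendsto (fun n : ℕ => Real.log (Real.log n) / n) atTop (𝓝 (0 * 0)) := by
      refine h2.congr' ?_
      filter_upwards [eventually_ge_atTop 3] with n hn3
      have : 0 < Real.log (n : ℝ) :=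
        Real.log_pos (by exact_mod_cast (by omega : 1 < n))
      simp only [Function.comp_apply]
      field_simp
    have h4 := (this.const_mul 2).sqrt
    simpa using h4
  refine h3.congr' ?_
  filter_upwards [eventually_ge_atTop 1] with n hn1
  rw [← mul_div_assoc, Real.sqrt_div' _ (by positivity), Real.rpow_neg (by positivity),
    ← Real.sqrt_eq_rpow, div_eq_mul_inv]

lemma rpow_mul_tailVar {β : ℝ} {n : ℕ} (hn : 1 ≤ n) :
    ((n : ℝ) ^ β) ^ 2 * tailVar β n = 1 := by
  have h : (0 : ℝ) < n := by exact_mod_cast hn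
  rw [tailVar, ← Real.rpow_natCast, ← Real.rpow_mul h.le, ← Real.rpow_add h]
  convert Real.rpow_zero _ using 2
  push_cast; ring

lemma rpow_mul_iterLogScale {β : ℝ} {n : ℕ} (hn : 1 ≤ n) :
    (n : ℝ) ^ β * iterLogScale β n = Real.sqrt (2 * Real.log (Real.log n)) := by
  have h : (0 : ℝ) < n := by exact_mod_cast hn
  rw [iterLogScale, ← mul_assoc, ← Real.rpow_add h, add_neg_cancel, Real.rpow_zero, one_mul]

lemma rpow_mul_rpow_neg_half_add {β : ℝ} {n : ℕ} (hn : 1 ≤ n) :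
    (n : ℝ) ^ β * (n : ℝ) ^ (-(1 / 2 + β)) = (n : ℝ) ^ (-(1 / 2 : ℝ)) := by
  rw [← Real.rpow_add (by exact_mod_cast hn)]
  congr 1; ring

/-- An exponential parameter `c * n ^ β * √(2 log log n)` is eventually negligible against the
size of the increments. -/
lemma eventually_param_le (β C c : ℝ) {ρ : ℝ} (hρ : 0 < ρ) :
    ∀ᶠ n : ℕ in atTop, c * ((n : ℝ) ^ β * Real.sqrt (2 * Real.log (Real.log n))) *
      (C * (n : ℝ) ^ (-(1 / 2 + β))) ≤ ρ := by
  have h := (tendsto_sqrt_log_log_mul_rpow.const_mul (c * C)).eventually_le_const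
    (u := ρ) (by simpa using hρ)
  filter_upwards [h, eventually_ge_atTop 1] with n hn h1
  rw [← rpow_mul_rpow_neg_half_add (β := β) h1] at hn
  linarith

/-- Choice of the parameter in the Chernoff bound at level `s * iterLogScale β n`. -/
lemma exists_chernoff_param (β : ℝ) {C s κ r : ℝ} (hs : 0 < s) (hκ : 0 < κ) (hr : 0 ≤ r)
    (h : r * κ < s ^ 2) :
    ∀ᶠ n : ℕ in atTop, ∃ l > 0, ∃ ρ ≤ 1, l * (C * (n : ℝ) ^ (-(1 / 2 + β))) ≤ ρ ∧
      (1 + ρ) / 2 * l ^ 2 * (κ * tailVar β n) - l * (s * iterLogScale β n) =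
        -(r * Real.log (Real.log n)) := by
  have hs2 : 0 < s ^ 2 := by positivity
  set ρ := 1 - r * κ / s ^ 2 with hρdef
  have hρ0 : 0 < ρ := by rw [hρdef, sub_pos, div_lt_one hs2]; exact h
  have hρ1 : ρ ≤ 1 := by
    have : 0 ≤ r * κ / s ^ 2 := by positivity
    linarith
  filter_upwards [eventually_param_le β C (s / κ) hρ0, eventually_ge_atTop 1,
    tendsto_log_log_natCast_atTop.eventually_gt_atTop 0] with n hn h1 hL
  have hn0 : (0 : ℝ) < n := by exact_mod_cast h1
  refine ⟨s / κ * ((n : ℝ) ^ β * Real.sqrt (2 * Real.log (Real.log n))), by positivity, ρ, hρ1,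
    hn, ?_⟩
  have e1 := rpow_mul_tailVar (β := β) h1
  have e2 := rpow_mul_iterLogScale (β := β) h1
  have e3 : Real.sqrt (2 * Real.log (Real.log n)) ^ 2 = 2 * Real.log (Real.log n) :=
    Real.sq_sqrt (by positivity)
  set w := Real.sqrt (2 * Real.log (Real.log n))
  calc _ = (1 + ρ) / 2 * (s ^ 2 / κ ^ 2) * w ^ 2 * κ * (((n : ℝ) ^ β) ^ 2 * tailVar β n) -
        s ^ 2 / κ * w * ((n : ℝ) ^ β * iterLogScale β n) := by ring
    _ = -((1 - ρ) * (s ^ 2 / κ) * w ^ 2 / 2) := by rw [e1, e2]; field_simp; ring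
    _ = _ := by rw [e3, hρdef]; field_simp; ring

lemma log_log_ceil_pow_bound {q r : ℝ} (hq : 1 < q) (hr : 0 ≤ r) {j : ℕ} (hj : 1 ≤ j) :
    Real.exp (-(r * Real.log (Real.log (⌈q ^ j⌉₊ : ℕ)))) ≤
      (j : ℝ) ^ (-r) * (Real.log q) ^ (-r) := by
  have hlq : 0 < Real.log q := Real.log_pos hq
  have hj0 : (0 : ℝ) < j := by exact_mod_cast hj
  have h1 : (j : ℝ) * Real.log q ≤ Real.log (⌈q ^ j⌉₊ : ℕ) := by
    rw [← Real.log_pow]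
    exact Real.log_le_log (by positivity) (Nat.le_ceil _)
  have h2 : 0 < Real.log (⌈q ^ j⌉₊ : ℕ) := lt_of_lt_of_le (by positivity) h1
  rw [← Real.mul_rpow hj0.le hlq.le]
  calc _ = (Real.log (⌈q ^ j⌉₊ : ℕ)) ^ (-r) := by
        rw [Real.rpow_def_of_pos h2]; congr 1; ring
    _ ≤ _ := Real.rpow_le_rpow_of_nonpos (by positivity) h1 (by linarith)

/-- Borel-Cantelli along a geometric subsequence. -/
lemma ae_eventually_notMem_of_le_exp_log_log {Ω : Type*} [MeasurableSpace Ω] {μ : Measure Ω}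
    {q r : ℝ} (hq : 1 < q) (hr : 1 < r) {E : ℕ → Set Ω}
    (hE : ∀ᶠ j in atTop, μ (E j) ≤
      ENNReal.ofReal (Real.exp (-(r * Real.log (Real.log (⌈q ^ j⌉₊ : ℕ)))))) :
    ∀ᵐ ω ∂μ, ∀ᶠ j in atTop, ω ∉ E j := by
  obtain ⟨j0, hj0⟩ := eventually_atTop.1 hE
  have hsum : Summable fun j : ℕ =>
      ((j + (j0 + 1) : ℕ) : ℝ) ^ (-r) * (Real.log q) ^ (-r) :=
    (((summable_nat_add_iff (j0 + 1)).2 (Real.summable_nat_rpow.2 (by linarith))).mul_right _)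
  have h := ae_eventually_notMem (μ := μ) (s := fun j => E (j + (j0 + 1)))
    (ne_top_of_le_ne_top hsum.tsum_ofReal_ne_top (ENNReal.tsum_le_tsum fun j =>
      (hj0 _ (by omega)).trans (ENNReal.ofReal_le_ofReal
        (log_log_ceil_pow_bound hq (by linarith) (by omega)))))
  filter_upwards [h] with ω hω
  obtain ⟨j1, hj1⟩ := eventually_atTop.1 hω
  refine eventually_atTop.2 ⟨j1 + (j0 + 1), fun j hj => ?_⟩
  have := hj1 (j - (j0 + 1)) (by omega)
  rwa [Nat.sub_add_cancel (by omega)] at this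

lemma iterLogScale_le_of_le_mul {β q : ℝ} (hβ : 0 < β) (hq : 0 < q) {n k : ℕ} (hn : 3 ≤ n)
    (hk : n ≤ k) (hkq : (k : ℝ) ≤ q * n) : iterLogScale β n ≤ q ^ β * iterLogScale β k := by
  have hn0 : (0 : ℝ) < n := by exact_mod_cast (by omega : 0 < n)
  have hk0 : (0 : ℝ) < k := by exact_mod_cast (by omega : 0 < k)
  have hnk : (n : ℝ) ≤ k := by exact_mod_cast hk
  have hln : 0 < Real.log n := Real.log_pos (by exact_mod_cast (by omega : 1 < n))
  rw [iterLogScale, iterLogScale, ← mul_assoc]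
  refine mul_le_mul ?_ (Real.sqrt_le_sqrt ?_) (Real.sqrt_nonneg _) (by positivity)
  · calc (n : ℝ) ^ (-β) ≤ ((k : ℝ) / q) ^ (-β) :=
          Real.rpow_le_rpow_of_nonpos (by positivity)
            (by rw [div_le_iff₀ hq]; linarith) (by linarith)
      _ = _ := by
          rw [Real.div_rpow hk0.le hq.le, Real.rpow_neg hq.le, div_inv_eq_mul, mul_comm]
  · have := Real.log_le_log hln (Real.log_le_log hn0 hnk)
    linarith

namespace TailIncrements

variable {Ω : Type*} [m0 : MeasurableSpace Ω] {μ : Measure Ω} [IsProbabilityMeasure μ]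
  {F : Filtration ℕ m0} {β A C : ℝ} {K : ℕ} {D : ℕ → Ω → ℝ}

lemma eventually_measure_le (h : TailIncrements μ F β A C K D) (hβ : 0 < β) {s κ r : ℝ}
    (hs : 0 < s) (hκ : 0 < κ) (hr : 0 ≤ r) (hrs : r * κ < s ^ 2) :
    ∀ᶠ n in atTop,
      (∀ I, A * (tailVar β n - tailVar β (n + I)) ≤ κ * tailVar β n →
        μ {ω | ∃ i ≤ I, s * iterLogScale β n ≤ ∑ k ∈ Finset.Ico n (n + i), D k ω} ≤
          ENNReal.ofReal (Real.exp (-(r * Real.log (Real.log n))))) ∧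
      ((∀ I, A * (tailVar β n - tailVar β (n + I)) ≤ κ * tailVar β n) →
        μ {ω | ∃ i, s * iterLogScale β n ≤ ∑ k ∈ Finset.Ico n (n + i), D k ω} ≤
          ENNReal.ofReal (Real.exp (-(r * Real.log (Real.log n))))) := by
  filter_upwards [exists_chernoff_param β (C := C) hs hκ hr hrs, eventually_ge_atTop K]
    with n ⟨l, hl0, ρ, hρ, hl, he⟩ hK
  rw [← he]
  exact ⟨fun I hI => h.measure_exists_le_sum_le hβ hK hρ hl0 hl I hI,
    fun hI => h.measure_exists_le_sum_le_of_forall hβ hK hρ hl0 hl hI⟩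

/-- The upper half of the law of the iterated logarithm along a geometric subsequence: bounds for
all future sums and for the oscillation up to the next element of the subsequence. -/
lemma ae_eventually_lt_geometric (h : TailIncrements μ F β A C K D) (hβ : 0 < β) (hA : 0 < A)
    {s₀ s₁ q q' : ℝ} (hs₀ : 0 < s₀) (hs₁ : 0 < s₁) (hAs : A < s₀ ^ 2) (hq : 1 < q) (hqq : q < q')
    (hq' : A * (1 - q' ^ (-(2 * β))) ≤ s₁ ^ 2 / 4) :
    ∀ᵐ ω ∂μ, ∀ᶠ j : ℕ in atTop,
      (∀ i, ∑ k ∈ Finset.Ico ⌈q ^ j⌉₊ (⌈q ^ j⌉₊ + i), D k ω <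
        s₀ * iterLogScale β ⌈q ^ j⌉₊) ∧
      (∀ i, ⌈q ^ j⌉₊ + i ≤ ⌈q ^ (j + 1)⌉₊ →
        ∑ k ∈ Finset.Ico ⌈q ^ j⌉₊ (⌈q ^ j⌉₊ + i), D k ω <
          s₁ * iterLogScale β ⌈q ^ j⌉₊) := by
  have hq0 : 0 < q := by linarith
  have hqt : Tendsto (fun j : ℕ => q ^ j) atTop atTop := tendsto_pow_atTop_atTop_of_one_lt hq
  have hnt : Tendsto (fun j : ℕ => ⌈q ^ j⌉₊) atTop atTop := tendsto_nat_ceil_atTop.comp hqt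
  have hr : ∃ r, 1 < r ∧ r * A < s₀ ^ 2 := by
    obtain ⟨r, h1, h2⟩ := exists_between ((one_lt_div hA).2 hAs)
    exact ⟨r, h1, (lt_div_iff₀ hA).1 h2⟩
  obtain ⟨r, hr1, hrA⟩ := hr
  have e0 := ae_eventually_notMem_of_le_exp_log_log (μ := μ) hq hr1
    (E := fun j => {ω | ∃ i, s₀ * iterLogScale β ⌈q ^ j⌉₊ ≤
      ∑ k ∈ Finset.Ico ⌈q ^ j⌉₊ (⌈q ^ j⌉₊ + i), D k ω})
    (by
      filter_upwards [hnt.eventually (h.eventually_measure_le hβ hs₀ hA (by linarith) hrA)]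
        with j hj
      refine hj.2 fun I => mul_le_mul_of_nonneg_left ?_ hA.le
      have : 0 ≤ tailVar β (⌈q ^ j⌉₊ + I) := Real.rpow_nonneg (Nat.cast_nonneg _) _
      linarith)
  have e1 := ae_eventually_notMem_of_le_exp_log_log (μ := μ) hq one_lt_two
    (E := fun j => {ω | ∃ i ≤ ⌈q ^ (j + 1)⌉₊ - ⌈q ^ j⌉₊, s₁ * iterLogScale β ⌈q ^ j⌉₊ ≤
      ∑ k ∈ Finset.Ico ⌈q ^ j⌉₊ (⌈q ^ j⌉₊ + i), D k ω})
    (by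
      filter_upwards [hnt.eventually (h.eventually_measure_le hβ hs₁ (κ := s₁ ^ 2 / 4) (r := 2)
        (by positivity) (by norm_num) (by nlinarith)), hnt.eventually_ge_atTop 1,
        hqt.eventually_ge_atTop (1 / (q' - q))] with j hj hj1 hjq
      refine hj.1 _ ?_
      have hle : ⌈q ^ j⌉₊ ≤ ⌈q ^ (j + 1)⌉₊ :=
        Nat.ceil_mono (pow_le_pow_right₀ hq.le (Nat.le_succ j))
      rw [Nat.add_sub_cancel' hle]
      have hn0 : (0 : ℝ) < (⌈q ^ j⌉₊ : ℕ) := by exact_mod_cast hj1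
      have hn1 : (0 : ℝ) < (⌈q ^ (j + 1)⌉₊ : ℕ) := by exact_mod_cast (by omega)
      have hup : ((⌈q ^ (j + 1)⌉₊ : ℕ) : ℝ) ≤ q' * (⌈q ^ j⌉₊ : ℕ) := by
        have c1 : ((⌈q ^ (j + 1)⌉₊ : ℕ) : ℝ) < q ^ (j + 1) + 1 :=
          Nat.ceil_lt_add_one (by positivity)
        have c2 : q ^ j ≤ ((⌈q ^ j⌉₊ : ℕ) : ℝ) := Nat.le_ceil _
        rw [div_le_iff₀ (by linarith)] at hjq
        have c3 : q' * q ^ j ≤ q' * (⌈q ^ j⌉₊ : ℕ) :=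
          mul_le_mul_of_nonneg_left c2 (by linarith)
        have c4 : q ^ (j + 1) = q ^ j * q := pow_succ q j
        nlinarith
      have hτ : q' ^ (-(2 * β)) * tailVar β ⌈q ^ j⌉₊ ≤ tailVar β ⌈q ^ (j + 1)⌉₊ := by
        rw [tailVar, tailVar, ← Real.mul_rpow (by linarith) hn0.le]
        exact Real.rpow_le_rpow_of_nonpos hn1 hup (by linarith)
      have hτ0 : 0 ≤ tailVar β ⌈q ^ j⌉₊ := Real.rpow_nonneg hn0.le _
      calc _ ≤ A * (tailVar β ⌈q ^ j⌉₊ - q' ^ (-(2 * β)) * tailVar β ⌈q ^ j⌉₊) :=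
            mul_le_mul_of_nonneg_left (by linarith) hA.le
        _ = A * (1 - q' ^ (-(2 * β))) * tailVar β ⌈q ^ j⌉₊ := by ring
        _ ≤ _ := mul_le_mul_of_nonneg_right hq' hτ0)
  filter_upwards [e0, e1] with ω h0 h1
  filter_upwards [h0, h1] with j hj0 hj1
  simp only [not_exists, not_and, not_le] at hj0 hj1
  exact ⟨hj0, fun i hi => hj1 i (by omega)⟩

/-- The upper half of the law of the iterated logarithm for martingale tails. -/
theorem ae_eventually_abs_sum_le (h : TailIncrements μ F β A C K D) (hβ : 0 < β) (hA : 0 < A)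
    {s : ℝ} (hs : 0 < s) (hAs : A < s ^ 2) :
    ∀ᵐ ω ∂μ, ∀ᶠ n in atTop, ∀ N ≥ n,
      |∑ k ∈ Finset.Ico n N, D k ω| ≤ s * iterLogScale β n := by
  obtain ⟨s₀, h₀, h₀s⟩ := exists_between (Real.sqrt_lt' hs |>.2 hAs)
  have hs₀ : 0 < s₀ := (Real.sqrt_nonneg A).trans_lt h₀
  have hAs₀ : A < s₀ ^ 2 := (Real.sqrt_lt' hs₀).1 h₀
  set s₁ := (s - s₀) / 2 with hs₁def
  have hs₁ : 0 < s₁ := by rw [hs₁def]; linarith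
  have hq' : ∃ q' : ℝ, 1 < q' ∧ (s₀ + s₁) * q' ^ β < s ∧
      A * (1 - q' ^ (-(2 * β))) < s₁ ^ 2 / 4 := by
    have c1 : Tendsto (fun x : ℝ => (s₀ + s₁) * x ^ β) (𝓝[>] 1) (𝓝 ((s₀ + s₁) * 1 ^ β)) :=
      (((Real.continuousAt_rpow_const 1 β (Or.inl one_ne_zero)).tendsto).const_mul _).mono_left
        nhdsWithin_le_nhds
    have c2 : Tendsto (fun x : ℝ => A * (1 - x ^ (-(2 * β)))) (𝓝[>] 1)
        (𝓝 (A * (1 - 1 ^ (-(2 * β))))) :=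
      (((Real.continuousAt_rpow_const 1 _ (Or.inl one_ne_zero)).tendsto).const_sub 1
        |>.const_mul _).mono_left nhdsWithin_le_nhds
    rw [Real.one_rpow] at c1 c2
    have d1 := c1.eventually_lt_const (u := s) (by rw [hs₁def]; linarith)
    have d2 := c2.eventually_lt_const (u := s₁ ^ 2 / 4) (by
      simp only [sub_self, mul_zero]; positivity)
    obtain ⟨x, hx1, hx2, hx3⟩ := (d1.and (d2.and self_mem_nhdsWithin)).exists
    exact ⟨x, hx3, hx1, hx2⟩
  obtain ⟨q', hq1, hq's, hq'A⟩ := hq'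
  obtain ⟨q, hq, hqq⟩ := exists_between hq1
  have hq0 : 0 < q := by linarith
  have hqt : Tendsto (fun j : ℕ => q ^ j) atTop atTop := tendsto_pow_atTop_atTop_of_one_lt hq
  filter_upwards [h.ae_eventually_lt_geometric hβ hA hs₀ hs₁ hAs₀ hq hqq hq'A.le,
    h.neg.ae_eventually_lt_geometric hβ hA hs₀ hs₁ hAs₀ hq hqq hq'A.le] with ω hω hω'
  obtain ⟨J, hJ⟩ := eventually_atTop.1 (hω.and (hω'.and
    ((hqt.eventually_ge_atTop (1 / (q' - q))).and (hqt.eventually_ge_atTop 3))))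
  refine eventually_atTop.2 ⟨⌈q ^ J⌉₊, fun n hn N hN => ?_⟩
  have hnq : q ^ J ≤ n := (Nat.le_ceil _).trans (by exact_mod_cast hn)
  obtain ⟨j, hj1, hj2⟩ := exists_nat_pow_near ((one_le_pow₀ hq.le).trans hnq) hq
  have hjJ : J ≤ j := by
    by_contra hlt
    have : q ^ (j + 1) ≤ q ^ J := pow_le_pow_right₀ hq.le (by omega)
    linarith
  obtain ⟨⟨a0, a1⟩, ⟨b0, b1⟩, hj3, hj4⟩ := hJ j hjJ
  have hjn : ⌈q ^ j⌉₊ ≤ n := Nat.ceil_le.2 hj1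
  have hnj : n ≤ ⌈q ^ (j + 1)⌉₊ := by
    have := hj2.le.trans (Nat.le_ceil _)
    exact_mod_cast this
  have hscale : iterLogScale β ⌈q ^ j⌉₊ ≤ q' ^ β * iterLogScale β n := by
    refine iterLogScale_le_of_le_mul hβ (by linarith) ?_ hjn ?_
    · have := hj4.trans (Nat.le_ceil _)
      exact_mod_cast this
    · rw [div_le_iff₀ (by linarith)] at hj3
      have c3 : q' * q ^ j ≤ q' * (⌈q ^ j⌉₊ : ℕ) :=
        mul_le_mul_of_nonneg_left (Nat.le_ceil _) (by linarith)
      have c4 : q ^ (j + 1) = q ^ j * q := pow_succ q j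
      nlinarith
  have hφ : 0 ≤ iterLogScale β n :=
    mul_nonneg (Real.rpow_nonneg (Nat.cast_nonneg _) _) (Real.sqrt_nonneg _)
  have hfin : (s₀ + s₁) * iterLogScale β ⌈q ^ j⌉₊ ≤ s * iterLogScale β n :=
    calc _ ≤ (s₀ + s₁) * (q' ^ β * iterLogScale β n) :=
          mul_le_mul_of_nonneg_left hscale (by linarith)
      _ = (s₀ + s₁) * q' ^ β * iterLogScale β n := by ring
      _ ≤ _ := mul_le_mul_of_nonneg_right hq's.le hφ
  have hsplit := Finset.sum_Ico_consecutive (fun k => D k ω) hjn hN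
  have A0 := a0 (N - ⌈q ^ j⌉₊)
  have B0 := b0 (N - ⌈q ^ j⌉₊)
  have A1 := a1 (n - ⌈q ^ j⌉₊) (by omega)
  have B1 := b1 (n - ⌈q ^ j⌉₊) (by omega)
  rw [Nat.add_sub_cancel' (by omega)] at A0 B0 A1 B1
  rw [Finset.sum_neg_distrib] at B0 B1
  rw [abs_le]
  constructor <;> linarith

end TailIncrements

/-- A conditional converse Borel-Cantelli lemma with deterministic lower bounds. -/
lemma ae_frequently_mem_of_le_measure_inter {Ω : Type*} [m0 : MeasurableSpace Ω] {μ : Measure Ω}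
    [IsProbabilityMeasure μ] {G : Filtration ℕ m0} {A : ℕ → Set Ω} {p : ℕ → ℝ} {J : ℕ}
    (hA : ∀ j ≥ J, MeasurableSet[G (j + 1)] (A j)) (hp : ∀ j, 0 ≤ p j) (hps : ¬Summable p)
    (hle : ∀ j ≥ J, ∀ E, MeasurableSet[G j] E → p j * μ.real E ≤ μ.real (E ∩ A j)) :
    ∀ᵐ ω ∂μ, ∃ᶠ j in atTop, ω ∈ A j := by
  have key : ∀ J' ≥ J, μ (⋂ k : ℕ, (A (J' + k))ᶜ) = 0 := by
    intro J' hJ'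
    let E : ℕ → Set Ω := fun n => ⋂ k ∈ Finset.range n, (A (J' + k))ᶜ
    have hE : ∀ n, MeasurableSet[G (J' + n)] (E n) := fun n =>
      Finset.measurableSet_biInter _ fun k hk =>
        (G.mono (by have := Finset.mem_range.1 hk; omega) _ (hA (J' + k) (by omega))).compl
    have hb : ∀ n, μ.real (E n) ≤ Real.exp (-∑ k ∈ Finset.range n, p (J' + k)) := by
      intro n
      induction n with
      | zero => simp [E]
      | succ n ih =>
        have hs : E (n + 1) = E n \ (E n ∩ A (J' + n)) := by
          ext ω
          simp only [E, Finset.range_add_one, Finset.mem_insert, mem_iInter, Set.mem_sdiff, mem_inter_iff,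
            mem_compl_iff]
          constructor
          · intro hω
            exact ⟨fun i hi => hω i (Or.inr hi), fun hh => hω n (Or.inl rfl) hh.2⟩
          · rintro ⟨h1, h2⟩ i (rfl | hi)
            · exact fun h3 => h2 ⟨h1, h3⟩
            · exact h1 i hi
        have hm : MeasurableSet (E n ∩ A (J' + n)) :=
          (G.le _ _ (hE n)).inter (G.le _ _ (hA _ (by omega)))
        rw [hs, measureReal_sdiff inter_subset_left hm, Finset.sum_range_succ, neg_add,
          Real.exp_add]
        have h1 := hle (J' + n) (by omega) (E n) (hE n)
        have h2 := Real.add_one_le_exp (-p (J' + n))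
        have h3 : 0 ≤ μ.real (E n) := measureReal_nonneg
        have h4 : 0 < Real.exp (-p (J' + n)) := Real.exp_pos _
        calc _ ≤ μ.real (E n) * (-p (J' + n) + 1) := by linarith
          _ ≤ μ.real (E n) * Real.exp (-p (J' + n)) := mul_le_mul_of_nonneg_left h2 h3
          _ ≤ _ := mul_le_mul_of_nonneg_right ih h4.le
    have hdiv : Tendsto (fun n => ∑ k ∈ Finset.range n, p (J' + k)) atTop atTop := by
      refine (not_summable_iff_tendsto_nat_atTop_of_nonneg fun k => hp _).1 fun hs => hps ?_
      refine (summable_nat_add_iff J').1 ?_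
      simpa [add_comm] using hs
    have h0 : μ.real (⋂ k : ℕ, (A (J' + k))ᶜ) ≤ 0 := by
      refine ge_of_tendsto' (Real.tendsto_exp_neg_atTop_nhds_zero.comp hdiv) fun n => ?_
      refine (measureReal_mono ?_).trans (hb n)
      exact fun ω hω => mem_iInter₂.2 fun k _ => mem_iInter.1 hω k
    exact (measureReal_eq_zero_iff).1 (le_antisymm h0 measureReal_nonneg)
  have hall : ∀ᵐ ω ∂μ, ∀ i : ℕ, ω ∉ ⋂ k : ℕ, (A (J + i + k))ᶜ :=
    ae_all_iff.2 fun i => measure_eq_zero_iff_ae_notMem.1 (key (J + i) (by omega))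
  filter_upwards [hall] with ω hω
  refine frequently_atTop.2 fun i => ?_
  have := hω i
  simp only [mem_iInter, mem_compl_iff, not_forall, not_not] at this
  obtain ⟨k, hk⟩ := this
  exact ⟨J + i + k, by omega, hk⟩

/-- Exponential tilting: the part of `exp (l * S)` carried outside `[x₁, x₂]` is dominated by
neighbouring exponentials. -/
lemma exp_sub_exp_sub_exp_le {l ε x₁ x₂ S : ℝ} (hl : 0 ≤ l) (hε : 0 ≤ ε) :
    Real.exp (l * S) - Real.exp ((1 + ε) * l * S - ε * l * x₂) -
      Real.exp ((1 - ε) * l * S + ε * l * x₁) ≤ if x₁ ≤ S then Real.exp (l * x₂) else 0 := by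
  have h2 := Real.exp_pos ((1 + ε) * l * S - ε * l * x₂)
  have h3 := Real.exp_pos ((1 - ε) * l * S + ε * l * x₁)
  split_ifs with h
  · rcases le_total S x₂ with h' | h'
    · have := Real.exp_le_exp.2 (mul_le_mul_of_nonneg_left h' hl)
      linarith
    · have : Real.exp (l * S) ≤ Real.exp ((1 + ε) * l * S - ε * l * x₂) := by
        refine Real.exp_le_exp.2 ?_
        have := mul_le_mul_of_nonneg_left h' (mul_nonneg hε hl)
        nlinarith
      have := Real.exp_pos (l * x₂)
      linarith
  · have : Real.exp (l * S) ≤ Real.exp ((1 - ε) * l * S + ε * l * x₁) := by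
      refine Real.exp_le_exp.2 ?_
      have := mul_le_mul_of_nonneg_left (not_le.1 h).le (mul_nonneg hε hl)
      nlinarith
    linarith

/-- A second moment type lower bound by exponential tilting. -/
lemma le_measureReal_inter_of_integral_exp {Ω : Type*} [MeasurableSpace Ω] {μ : Measure Ω}
    [IsFiniteMeasure μ] {S : Ω → ℝ} (hS : Measurable S) {E : Set Ω} (hE : MeasurableSet E)
    {l ε x₁ x₂ c : ℝ} (hl : 0 ≤ l) (hε : 0 ≤ ε)
    (h_int : ∀ t, Integrable (fun ω => E.indicator (fun _ => (1 : ℝ)) ω * Real.exp (t * S ω)) μ)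
    (h1 : c ≤ ∫ ω, E.indicator (fun _ => (1 : ℝ)) ω * Real.exp (l * S ω) ∂μ)
    (h2 : Real.exp (-(ε * l * x₂)) *
      ∫ ω, E.indicator (fun _ => (1 : ℝ)) ω * Real.exp ((1 + ε) * l * S ω) ∂μ ≤ 1 / 4 * c)
    (h3 : Real.exp (ε * l * x₁) *
      ∫ ω, E.indicator (fun _ => (1 : ℝ)) ω * Real.exp ((1 - ε) * l * S ω) ∂μ ≤ 1 / 4 * c) :
    1 / 2 * c ≤ Real.exp (l * x₂) * μ.real (E ∩ {ω | x₁ ≤ S ω}) := by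
  have hEA : MeasurableSet (E ∩ {ω | x₁ ≤ S ω}) :=
    hE.inter (measurableSet_le measurable_const hS)
  set f : Ω → ℝ := E.indicator fun _ => 1 with hf
  have hupper : ∫ ω, f ω * Real.exp (l * S ω) ∂μ -
      Real.exp (-(ε * l * x₂)) * ∫ ω, f ω * Real.exp ((1 + ε) * l * S ω) ∂μ -
      Real.exp (ε * l * x₁) * ∫ ω, f ω * Real.exp ((1 - ε) * l * S ω) ∂μ ≤
      Real.exp (l * x₂) * μ.real (E ∩ {ω | x₁ ≤ S ω}) := by
    have i2 := (h_int ((1 + ε) * l)).const_mul (Real.exp (-(ε * l * x₂)))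
    have i3 := (h_int ((1 - ε) * l)).const_mul (Real.exp (ε * l * x₁))
    have i12 : Integrable (fun ω => f ω * Real.exp (l * S ω) -
      Real.exp (-(ε * l * x₂)) * (f ω * Real.exp ((1 + ε) * l * S ω))) μ := (h_int l).sub i2
    rw [← integral_const_mul, ← integral_const_mul, ← integral_sub (h_int l) i2,
      ← integral_sub i12 i3, mul_comm (Real.exp (l * x₂)),
      ← smul_eq_mul (μ.real _), ← integral_indicator_const _ hEA]
    refine integral_mono (i12.sub i3) ((integrable_const _).indicator hEA) fun ω => ?_
    have ht := exp_sub_exp_sub_exp_le (x₁ := x₁) (x₂ := x₂) (S := S ω) hl hε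
    rw [sub_eq_add_neg ((1 + ε) * l * S ω), Real.exp_add, Real.exp_add] at ht
    by_cases hω : ω ∈ E
    · have hfω : f ω = 1 := by simp [hf, hω]
      have hi : (E ∩ {ω | x₁ ≤ S ω}).indicator (fun _ => Real.exp (l * x₂)) ω =
          if x₁ ≤ S ω then Real.exp (l * x₂) else 0 := by
        by_cases hx : x₁ ≤ S ω <;> simp [hω, hx]
      rw [hi]
      refine le_trans (le_of_eq ?_) ht
      simp only [hfω]
      ring
    · have hfω : f ω = 0 := by simp [hf, hω]
      simp [hfω, hω]
  linarith only [hupper, h1, h2, h3]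

/-- The exponents produced by the tilted exponential moments are negligible. -/
lemma tilted_exponent_le {a ε l v z : ℝ} (ha0 : 0 ≤ a) (hε : 0 < ε) (hε1 : ε ≤ 1)
    (ha : l ^ 2 * v = 2 * a) (hz : l * z = 2 * a) {δ : ℝ} (hδ : δ = ε ∨ δ = -ε) :
    (1 + ε ^ 2 / 12) / 2 * ((1 + δ) * l) ^ 2 * (1 * v) + -(δ * l * ((1 + δ) * z)) ≤
      (1 - 2 * (ε ^ 2 / 12)) * a + -(ε ^ 2 / 2 * a) := by
  have hδ2 : δ ^ 2 = ε ^ 2 := by rcases hδ with rfl | rfl <;> ring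
  have hδ1 : δ ≤ 1 := by rcases hδ with rfl | rfl <;> linarith
  have hδ0 : -1 ≤ δ := by rcases hδ with rfl | rfl <;> linarith
  have e : (1 + ε ^ 2 / 12) / 2 * ((1 + δ) * l) ^ 2 * (1 * v) + -(δ * l * ((1 + δ) * z)) =
      ((1 + ε ^ 2 / 12) * (1 + δ) ^ 2 - 2 * δ * (1 + δ)) * a := by
    linear_combination (1 + ε ^ 2 / 12) / 2 * (1 + δ) ^ 2 * ha - δ * (1 + δ) * hz
  rw [e]
  have h4 : (1 + δ) ^ 2 ≤ 4 := by nlinarith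
  have hk : ε ^ 2 * (1 + δ) ^ 2 ≤ ε ^ 2 * 4 := mul_le_mul_of_nonneg_left h4 (sq_nonneg ε)
  have hb : (1 + ε ^ 2 / 12) * (1 + δ) ^ 2 - 2 * δ * (1 + δ) ≤
      (1 - 2 * (ε ^ 2 / 12)) + -(ε ^ 2 / 2) := by nlinarith
  nlinarith [mul_le_mul_of_nonneg_right hb ha0]

namespace TailIncrements

variable {Ω : Type*} [m0 : MeasurableSpace Ω] {μ : Measure Ω} [IsProbabilityMeasure μ]
  {F : Filtration ℕ m0} {β C : ℝ} {K : ℕ} {D : ℕ → Ω → ℝ}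

/-- The tilted exponential moments, compared with the untilted one. -/
lemma exp_mul_integral_tilted_le (h : TailIncrements μ F β 1 C K D)
    (hβ : 0 < β) {n i : ℕ} (hn : K ≤ n) {l ε z a : ℝ} (hl0 : 0 ≤ l) (hε : 0 < ε) (hε1 : ε ≤ 1)
    (hl : (1 + ε) * l * (C * (n : ℝ) ^ (-(1 / 2 + β))) ≤ ε ^ 2 / 12) (ha0 : 0 ≤ a)
    (ha : l ^ 2 * (tailVar β n - tailVar β (n + i)) = 2 * a) (hz : l * z = 2 * a)
    (ha1 : Real.exp (-(ε ^ 2 / 2 * a)) ≤ 1 / 4) {f : Ω → ℝ} (hf : Measurable[F n] f)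
    (hb : ∃ b, ∀ ω, |f ω| ≤ b) (h0 : ∀ ω, 0 ≤ f ω) {δ : ℝ} (hδ : δ = ε ∨ δ = -ε) :
    Real.exp (-(δ * l * ((1 + δ) * z))) *
      ∫ ω, f ω * Real.exp ((1 + δ) * l * ∑ k ∈ Finset.Ico n (n + i), D k ω) ∂μ ≤
      1 / 4 * (Real.exp ((1 - 2 * (ε ^ 2 / 12)) * a) * ∫ ω, f ω ∂μ) := by
  have hI : 0 ≤ ∫ ω, f ω ∂μ := integral_nonneg h0
  have hρ1 : ε ^ 2 / 12 ≤ 1 := by nlinarith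
  have hc0 : 0 ≤ C * (n : ℝ) ^ (-(1 / 2 + β)) :=
    mul_nonneg h.C_nonneg (Real.rpow_nonneg (Nat.cast_nonneg _) _)
  have hδ1 : 1 + δ ≤ 1 + ε := by rcases hδ with rfl | rfl <;> linarith
  have hδ0 : 0 ≤ 1 + δ := by rcases hδ with rfl | rfl <;> linarith
  have habs : |(1 + δ) * l| * (C * (n : ℝ) ^ (-(1 / 2 + β))) ≤ ε ^ 2 / 12 := by
    rw [abs_of_nonneg (mul_nonneg hδ0 hl0)]
    exact (mul_le_mul_of_nonneg_right (mul_le_mul_of_nonneg_right hδ1 hl0) hc0).trans hl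
  have b2 := h.integral_mul_exp_sum_le hβ hn hf hb h0 hρ1 habs i
  have e := tilted_exponent_le ha0 hε hε1 ha hz hδ
  generalize tailVar β n - tailVar β (n + i) = v at *
  generalize (1 + ε ^ 2 / 12) / 2 * ((1 + δ) * l) ^ 2 * (1 * v) = u at *
  generalize -(δ * l * ((1 + δ) * z)) = w at *
  refine (mul_le_mul_of_nonneg_left b2 (Real.exp_pos _).le).trans ?_
  calc Real.exp w * (Real.exp u * ∫ ω, f ω ∂μ)
      = Real.exp (u + w) * ∫ ω, f ω ∂μ := by rw [Real.exp_add]; ring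
    _ ≤ Real.exp ((1 - 2 * (ε ^ 2 / 12)) * a + -(ε ^ 2 / 2 * a)) * ∫ ω, f ω ∂μ :=
        mul_le_mul_of_nonneg_right (Real.exp_le_exp.2 e) hI
    _ = Real.exp (-(ε ^ 2 / 2 * a)) * (Real.exp ((1 - 2 * (ε ^ 2 / 12)) * a) * ∫ ω, f ω ∂μ) := by
        rw [Real.exp_add]; ring
    _ ≤ _ := mul_le_mul_of_nonneg_right ha1 (mul_nonneg (Real.exp_pos _).le hI)

/-- A conditional lower bound for the probability of a moderate deviation, in terms of the
exponents: `a` is half of `l ^ 2` times the variance. -/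
lemma le_measureReal_inter (h : TailIncrements μ F β 1 C K D)
    (hv : ∀ k ≥ K, ∀ f : Ω → ℝ, Measurable[F k] f → (∃ b, ∀ ω, |f ω| ≤ b) →
      ∫ ω, f ω * D k ω ^ 2 ∂μ = (tailVar β k - tailVar β (k + 1)) * ∫ ω, f ω ∂μ)
    (hβ : 0 < β) {n i : ℕ} (hn : K ≤ n) {l ε z a : ℝ} (hl0 : 0 ≤ l) (hε : 0 < ε) (hε1 : ε ≤ 1)
    (hl : (1 + ε) * l * (C * (n : ℝ) ^ (-(1 / 2 + β))) ≤ ε ^ 2 / 12)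
    (ha : l ^ 2 * (tailVar β n - tailVar β (n + i)) = 2 * a) (hz : l * z = 2 * a)
    (ha1 : Real.exp (-(ε ^ 2 / 2 * a)) ≤ 1 / 4) {E : Set Ω} (hE : MeasurableSet[F n] E) :
    1 / 2 * Real.exp (-((1 + 3 * ε) * a)) * μ.real E ≤
      μ.real (E ∩ {ω | (1 - ε) * z ≤ ∑ k ∈ Finset.Ico n (n + i), D k ω}) := by
  have hc0 : 0 ≤ C * (n : ℝ) ^ (-(1 / 2 + β)) :=
    mul_nonneg h.C_nonneg (Real.rpow_nonneg (Nat.cast_nonneg _) _)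
  have hρ1 : ε ^ 2 / 12 ≤ 1 := by nlinarith
  have ha0 : 0 ≤ a := by
    have h1 := sub_nonneg.2 (tailVar_antitone hβ (h.one_le.trans hn) (Nat.le_add_right n i))
    have h2 := mul_nonneg (sq_nonneg l) h1
    linarith only [h2, ha]
  have hE' : MeasurableSet E := F.le _ _ hE
  have hfm : Measurable[F n] (E.indicator fun _ => (1 : ℝ)) :=
    (measurable_const (a := (1 : ℝ))).indicator hE
  have hfb : ∃ b, ∀ ω, |E.indicator (fun _ => (1 : ℝ)) ω| ≤ b := ⟨1, fun ω => by
    by_cases hω : ω ∈ E <;> simp [hω]⟩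
  have hf0 : ∀ ω, 0 ≤ E.indicator (fun _ => (1 : ℝ)) ω :=
    fun ω => indicator_nonneg (fun _ _ => zero_le_one) ω
  have hfi : ∫ ω, E.indicator (fun _ => (1 : ℝ)) ω ∂μ = μ.real E := by
    rw [integral_indicator_const _ hE']; simp
  have h_int : ∀ t, Integrable (fun ω => E.indicator (fun _ => (1 : ℝ)) ω *
      Real.exp (t * ∑ k ∈ Finset.Ico n (n + i), D k ω)) μ := fun t => by
    obtain ⟨hm, b, hb⟩ := h.mul_exp_sum_bdd hβ hn hfm hfb t i
    exact integrable_of_abs_le (hm.mono (F.le _) le_rfl) hb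
  have b1 := h.le_integral_mul_exp_sum hv hβ hn hfm hfb hf0 hρ1 (l := l) (by
    rw [abs_of_nonneg hl0]
    refine le_trans (mul_le_mul_of_nonneg_right ?_ hc0) hl
    nlinarith only [hl0, hε, mul_nonneg hε.le hl0]) i
  have b2 := h.exp_mul_integral_tilted_le hβ hn hl0 hε hε1 hl ha0 ha hz ha1 hfm hfb hf0
    (Or.inl rfl)
  have b3 := h.exp_mul_integral_tilted_le hβ hn hl0 hε hε1 hl ha0 ha hz ha1 hfm hfb hf0
    (Or.inr rfl)
  have e1 : (1 - 2 * (ε ^ 2 / 12)) / 2 * l ^ 2 * (tailVar β n - tailVar β (n + i)) =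
      (1 - 2 * (ε ^ 2 / 12)) * a := by
    rw [mul_assoc, ha]; ring
  have e3 : -(-ε * l * ((1 + -ε) * z)) = ε * l * ((1 - ε) * z) := by ring
  rw [hfi] at b1 b2 b3
  rw [e1] at b1
  rw [e3, ← sub_eq_add_neg] at b3
  have hfinal := le_measureReal_inter_of_integral_exp
    ((h.measurable_sum hn i).mono (F.le _) le_rfl) hE' hl0 hε.le h_int b1 b2 b3
  have hlx : l * ((1 + ε) * z) = 2 * (1 + ε) * a := by linear_combination (1 + ε) * hz
  have hcomp : Real.exp (-((1 + 3 * ε) * a)) * Real.exp (l * ((1 + ε) * z)) ≤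
      Real.exp ((1 - 2 * (ε ^ 2 / 12)) * a) := by
    rw [← Real.exp_add, hlx]
    refine Real.exp_le_exp.2 ?_
    have : 0 ≤ a * (ε * (1 - ε / 6)) :=
      mul_nonneg ha0 (mul_nonneg hε.le (by linarith only [hε1]))
    nlinarith only [this]
  refine le_of_mul_le_mul_left ?_ (Real.exp_pos (l * ((1 + ε) * z)))
  refine le_trans ?_ hfinal
  have := mul_le_mul_of_nonneg_right hcomp (measureReal_nonneg (μ := μ) (s := E))
  linarith only [this]

end TailIncrements

lemma iterLogScale_mul_le {β : ℝ} {q n : ℕ} (hq : 1 ≤ q) (hn : q ≤ n)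
    (hL : 1 ≤ Real.log (Real.log n)) :
    iterLogScale β (n * q) ≤ 2 * (q : ℝ) ^ (-β) * iterLogScale β n := by
  have hq0 : (0 : ℝ) < q := by exact_mod_cast hq
  have hn0 : (0 : ℝ) < n := by exact_mod_cast hq.trans hn
  have hln0 : 0 ≤ Real.log n := Real.log_nonneg (by exact_mod_cast hq.trans hn)
  have hln : 0 < Real.log n := by
    rcases hln0.eq_or_lt with h | h
    · rw [← h, Real.log_zero] at hL; linarith
    · exact h
  have h1 : Real.log ((n * q : ℕ) : ℝ) ≤ 2 * Real.log n := by
    push_cast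
    rw [Real.log_mul hn0.ne' hq0.ne']
    have := Real.log_le_log hq0 (show (q : ℝ) ≤ n by exact_mod_cast hn)
    linarith
  have h0 : 0 < Real.log ((n * q : ℕ) : ℝ) := by
    refine hln.trans_le (Real.log_le_log hn0 ?_)
    exact_mod_cast Nat.le_mul_of_pos_right n hq
  have h2 : Real.log (Real.log ((n * q : ℕ) : ℝ)) ≤ 4 * Real.log (Real.log n) := by
    have := Real.log_le_log h0 h1
    rw [Real.log_mul two_ne_zero hln.ne'] at this
    have := Real.log_two_lt_d9
    linarith
  have h3 : Real.sqrt (2 * Real.log (Real.log ((n * q : ℕ) : ℝ))) ≤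
      2 * Real.sqrt (2 * Real.log (Real.log n)) := by
    rw [show (2 : ℝ) * Real.sqrt (2 * Real.log (Real.log n)) =
      Real.sqrt (2 ^ 2 * (2 * Real.log (Real.log n))) by
        rw [Real.sqrt_mul (by norm_num : (0 : ℝ) ≤ 2 ^ 2), Real.sqrt_sq (by norm_num)]]
    exact Real.sqrt_le_sqrt (by linarith)
  rw [iterLogScale, iterLogScale]
  calc _ ≤ ((n * q : ℕ) : ℝ) ^ (-β) * (2 * Real.sqrt (2 * Real.log (Real.log n))) :=
        mul_le_mul_of_nonneg_left h3 (Real.rpow_nonneg (Nat.cast_nonneg _) _)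
    _ = _ := by
        push_cast
        rw [Real.mul_rpow hn0.le hq0.le]; ring

lemma tailVar_mul (β : ℝ) (n q : ℕ) : tailVar β (n * q) = tailVar β n * tailVar β q := by
  rw [tailVar, tailVar, tailVar, Nat.cast_mul, Real.mul_rpow (Nat.cast_nonneg _)
    (Nat.cast_nonneg _)]

lemma exists_geometric_ratio {β c d : ℝ} (hβ : 0 < β) (hc : c < 1) (hd : 0 < d) :
    ∃ q : ℕ, 2 ≤ q ∧ c ≤ 1 - tailVar β q ∧ 4 * (q : ℝ) ^ (-β) ≤ d := by
  have h1 : Tendsto (fun q : ℕ => tailVar β q) atTop (𝓝 0) :=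
    (tendsto_rpow_neg_atTop (by positivity : 0 < 2 * β)).comp tendsto_natCast_atTop_atTop
  have h2 : Tendsto (fun q : ℕ => 4 * (q : ℝ) ^ (-β)) atTop (𝓝 (4 * 0)) :=
    ((tendsto_rpow_neg_atTop hβ).comp tendsto_natCast_atTop_atTop).const_mul 4
  obtain ⟨q, hq, hq1, hq2⟩ := ((eventually_ge_atTop 2).and
    ((h1.eventually_le_const (u := 1 - c) (by linarith)).and
      (h2.eventually_le_const (u := d) (by linarith)))).exists
  exact ⟨q, hq, by linarith, hq2⟩

namespace TailIncrements

variable {Ω : Type*} [m0 : MeasurableSpace Ω] {μ : Measure Ω} [IsProbabilityMeasure μ]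
  {F : Filtration ℕ m0} {β C : ℝ} {K : ℕ} {D : ℕ → Ω → ℝ}

lemma eventually_le_measureReal_inter (h : TailIncrements μ F β 1 C K D)
    (hv : ∀ k ≥ K, ∀ f : Ω → ℝ, Measurable[F k] f → (∃ b, ∀ ω, |f ω| ≤ b) →
      ∫ ω, f ω * D k ω ^ 2 ∂μ = (tailVar β k - tailVar β (k + 1)) * ∫ ω, f ω ∂μ)
    (hβ : 0 < β) {ε y κ : ℝ} (hε : 0 < ε) (hε1 : ε ≤ 1) (hy : 0 < y) (hκ : 0 < κ)
    (hyκ : y ^ 2 * (1 + 3 * ε) ≤ κ) :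
    ∀ᶠ n in atTop, ∀ i, tailVar β n - tailVar β (n + i) = κ * tailVar β n →
      ∀ E, MeasurableSet[F n] E → 1 / 2 * Real.exp (-Real.log (Real.log n)) * μ.real E ≤
        μ.real (E ∩ {ω | (1 - ε) * y * iterLogScale β n ≤
          ∑ k ∈ Finset.Ico n (n + i), D k ω}) := by
  have ha : Tendsto (fun n : ℕ => Real.exp (-(ε ^ 2 / 2 * (y ^ 2 / κ * Real.log (Real.log n)))))
      atTop (𝓝 0) :=
    Real.tendsto_exp_neg_atTop_nhds_zero.comp
      ((tendsto_log_log_natCast_atTop.const_mul_atTop (by positivity : 0 < y ^ 2 / κ)).const_mul_atTop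
        (by positivity))
  filter_upwards [eventually_ge_atTop K, ha.eventually_le_const (u := 1 / 4) (by norm_num),
    eventually_param_le β C ((1 + ε) * (y / κ)) (show 0 < ε ^ 2 / 12 by positivity),
    tendsto_log_log_natCast_atTop.eventually_ge_atTop 0] with n hK hn1 hn2 hn3 i hi E hE
  have h1 : 1 ≤ n := h.one_le.trans hK
  have hsq := Real.sq_sqrt (mul_nonneg zero_le_two hn3)
  have ht := rpow_mul_tailVar (β := β) h1
  have hs := rpow_mul_iterLogScale (β := β) h1
  have hnβ : 0 ≤ (n : ℝ) ^ β := Real.rpow_nonneg (Nat.cast_nonneg _) _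
  have hr := Real.sqrt_nonneg (2 * Real.log (Real.log n))
  have key := h.le_measureReal_inter hv hβ hK (i := i)
    (l := y / κ * ((n : ℝ) ^ β * Real.sqrt (2 * Real.log (Real.log n))))
    (z := y * iterLogScale β n) (a := y ^ 2 / κ * Real.log (Real.log n))
    (by positivity) hε hε1 (by rw [← mul_assoc (1 + ε)]; exact hn2)
    (by
      rw [hi, mul_pow, mul_pow, hsq]
      have : (y / κ) ^ 2 * κ = y ^ 2 / κ := by field_simp
      linear_combination (y / κ) ^ 2 * κ * (2 * Real.log (Real.log n)) * ht +
        2 * Real.log (Real.log n) * this)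
    (by
      have : y / κ * y = y ^ 2 / κ := by ring
      linear_combination y / κ * y * Real.sqrt (2 * Real.log (Real.log n)) * hs +
        y / κ * y * hsq + 2 * Real.log (Real.log n) * this)
    hn1 hE
  rw [← mul_assoc (1 - ε) y] at key
  refine le_trans (mul_le_mul_of_nonneg_right (mul_le_mul_of_nonneg_left
    (Real.exp_le_exp.2 (neg_le_neg ?_)) (by norm_num)) measureReal_nonneg) key
  have : (1 + 3 * ε) * (y ^ 2 / κ) ≤ 1 := by
    rw [← mul_div_assoc, div_le_one hκ]; linarith
  nlinarith only [mul_le_mul_of_nonneg_right this hn3]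

/-- The lower half of the law of the iterated logarithm, for increments with exact conditional
variances. -/
theorem ae_frequently_le_sum (h : TailIncrements μ F β 1 C K D)
    (hv : ∀ k ≥ K, ∀ f : Ω → ℝ, Measurable[F k] f → (∃ b, ∀ ω, |f ω| ≤ b) →
      ∫ ω, f ω * D k ω ^ 2 ∂μ = (tailVar β k - tailVar β (k + 1)) * ∫ ω, f ω ∂μ)
    (hβ : 0 < β) {s : ℝ} (hs0 : 0 < s) (hs : s < 1) :
    ∀ᵐ ω ∂μ, ∃ᶠ n in atTop, ∀ᶠ N in atTop,
      s * iterLogScale β n ≤ ∑ k ∈ Finset.Ico n N, D k ω := by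
  obtain ⟨δ, hδ⟩ : ∃ δ, δ = (1 - s) / 2 := ⟨_, rfl⟩
  have hδ0 : 0 < δ := by linarith
  have hδ1 : δ < 1 / 2 := by linarith
  obtain ⟨ε, hεδ⟩ : ∃ ε, ε = δ / 4 := ⟨_, rfl⟩
  have hε0 : 0 < ε := by linarith
  have hε1 : ε ≤ 1 := by linarith
  obtain ⟨y, hy⟩ : ∃ y, y = 1 - δ := ⟨_, rfl⟩
  have hy0 : 0 < y := by linarith
  have hys : s < (1 - ε) * y := by
    rw [hεδ, hy, show s = 1 - 2 * δ by linarith]; nlinarith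
  have hy1 : y ^ 2 * (1 + 3 * ε) < 1 := by
    rw [hεδ, hy]
    nlinarith [mul_pos hδ0 hδ0, mul_pos (mul_pos hδ0 hδ0) hδ0]
  obtain ⟨q, hq2, hqκ, hqd⟩ := exists_geometric_ratio hβ hy1 (sub_pos.2 hys)
  have hq0 : 0 < q := by omega
  have hκ0 : 0 < 1 - tailVar β q := lt_of_lt_of_le (by positivity) hqκ
  have hpow : Tendsto (fun j : ℕ => q ^ j) atTop atTop :=
    tendsto_pow_atTop_atTop_of_one_lt (by omega)
  have hlogq : 0 < Real.log q := Real.log_pos (by exact_mod_cast hq2)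
  obtain ⟨J, hJ⟩ := eventually_atTop.1 ((hpow.eventually
    ((h.eventually_le_measureReal_inter hv hβ hε0 hε1 hy0 hκ0 hqκ).and
      (eventually_ge_atTop K))).and (eventually_ge_atTop 1))
  have hstep : ∀ j, q ^ j + (q ^ (j + 1) - q ^ j) = q ^ (j + 1) := fun j =>
    Nat.add_sub_cancel' (Nat.pow_le_pow_right hq0 (Nat.le_succ j))
  let G : Filtration ℕ m0 := ⟨fun j => F (q ^ j), fun i j hij =>
    F.mono (Nat.pow_le_pow_right hq0 hij), fun i => F.le _⟩
  have hev : ∀ᵐ ω ∂μ, ∃ᶠ j in atTop, ω ∈ {ω | (1 - ε) * y * iterLogScale β (q ^ j) ≤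
      ∑ k ∈ Finset.Ico (q ^ j) (q ^ j + (q ^ (j + 1) - q ^ j)), D k ω} := by
    refine ae_frequently_mem_of_le_measure_inter (G := G)
      (p := fun j : ℕ => 1 / 2 * (Real.log q)⁻¹ * (j : ℝ)⁻¹) (J := J) ?_ ?_ ?_ ?_
    · intro j hj
      have := h.measurable_sum (hJ j hj).1.2 (q ^ (j + 1) - q ^ j)
      exact (this.mono (F.mono (hstep j).le) le_rfl) measurableSet_Ici
    · intro j; positivity
    · rw [summable_mul_left_iff (by positivity)]
      exact Real.not_summable_natCast_inv
    · intro j hj E hE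
      have hb := (hJ j hj).1.1 (q ^ (j + 1) - q ^ j) (by
        rw [hstep, pow_succ, tailVar_mul]; ring) E hE
      refine le_trans (le_of_eq ?_) hb
      have hj0 : (0 : ℝ) < j := by exact_mod_cast (hJ j hj).2
      push_cast
      rw [Real.log_pow, Real.exp_neg, Real.exp_log (by positivity), mul_inv]
      ring
  filter_upwards [hev, h.ae_eventually_abs_sum_le hβ one_pos (s := 2) two_pos (by norm_num)]
    with ω hω hup
  have hup' := ((tendsto_add_atTop_iff_nat 1).2 hpow).eventually hup
  have hL := hpow.eventually ((tendsto_log_log_natCast_atTop.eventually_ge_atTop 1).and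
    (eventually_ge_atTop q))
  refine hpow.frequently ((hω.and_eventually (hup'.and hL)).mono ?_)
  rintro j ⟨h1, h2, h3, h4⟩
  filter_upwards [eventually_ge_atTop (q ^ (j + 1))] with N hN
  simp only [hstep] at h1
  have h5 := (abs_le.1 (h2 N hN)).1
  rw [← Finset.sum_Ico_consecutive _ (Nat.pow_le_pow_right hq0 (Nat.le_succ j)) hN]
  have h6 := iterLogScale_mul_le (β := β) (by omega) h4 h3
  rw [← pow_succ] at h6
  have h7 : 0 ≤ iterLogScale β (q ^ j) :=
    mul_nonneg (Real.rpow_nonneg (Nat.cast_nonneg _) _) (Real.sqrt_nonneg _)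
  nlinarith [mul_le_mul_of_nonneg_right hqd h7]

end TailIncrements

lemma tailVar_lt_tailVar {β : ℝ} (hβ : 0 < β) {k : ℕ} (hk : 1 ≤ k) :
    tailVar β (k + 1) < tailVar β k :=
  Real.rpow_lt_rpow_of_neg (by exact_mod_cast hk) (by exact_mod_cast Nat.lt_succ_self k)
    (by linarith)

lemma limsup_eq_and_liminf_eq {Y : ℕ → ℝ} {c : ℝ}
    (h1 : ∀ η > 0, ∀ᶠ n in atTop, |Y n| ≤ c + η)
    (h2 : ∀ η > 0, ∃ᶠ n in atTop, c - η ≤ Y n)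
    (h3 : ∀ η > 0, ∃ᶠ n in atTop, Y n ≤ -(c - η)) :
    limsup Y atTop = c ∧ liminf Y atTop = -c := by
  have hu : ∀ η > 0, ∀ᶠ n in atTop, Y n ≤ c + η := fun η hη =>
    (h1 η hη).mono fun n hn => (abs_le.1 hn).2
  have hl : ∀ η > 0, ∀ᶠ n in atTop, -(c + η) ≤ Y n := fun η hη =>
    (h1 η hη).mono fun n hn => (abs_le.1 hn).1
  have hbu : IsBoundedUnder (· ≤ ·) atTop Y := ⟨c + 1, hu 1 one_pos⟩
  have hbl : IsBoundedUnder (· ≥ ·) atTop Y := ⟨-(c + 1), hl 1 one_pos⟩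
  refine ⟨le_antisymm ?_ ?_, le_antisymm ?_ ?_⟩
  · exact le_of_forall_pos_le_add fun η hη => limsup_le_of_le hbl.isCoboundedUnder_le (hu η hη)
  · refine le_of_forall_pos_le_add fun η hη => ?_
    have := le_limsup_of_frequently_le (h2 η hη) hbu
    linarith
  · refine le_of_forall_pos_le_add fun η hη => ?_
    have := liminf_le_of_frequently_le (h3 η hη) hbl
    linarith
  · refine le_of_forall_pos_le_add fun η hη => ?_
    have := le_liminf_of_le hbu.isCoboundedUnder_ge (hl η hη)
    linarith

/-- Martingale increments whose conditional variances `v k` are comparable with the increments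
of `tailVar β`. -/
structure VarianceIncrements {Ω : Type*} [m0 : MeasurableSpace Ω] (μ : Measure Ω)
    (F : Filtration ℕ m0) (β C c c' : ℝ) (K : ℕ) (D v : ℕ → Ω → ℝ) : Prop where
  one_le : 1 ≤ K
  meas : ∀ k ≥ K, Measurable[F (k + 1)] (D k)
  bdd : ∀ k ≥ K, ∀ ω, |D k ω| ≤ C * (k : ℝ) ^ (-(1 / 2 + β))
  mean : ∀ k ≥ K, ∀ f : Ω → ℝ, Measurable[F k] f → (∃ b, ∀ ω, |f ω| ≤ b) →
    ∫ ω, f ω * D k ω ∂μ = 0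
  measVar : ∀ k ≥ K, Measurable[F k] (v k)
  le_var : ∀ k ≥ K, ∀ ω, c * (tailVar β k - tailVar β (k + 1)) ≤ v k ω
  var_le : ∀ k ≥ K, ∀ ω, v k ω ≤ c' * (tailVar β k - tailVar β (k + 1))
  var : ∀ k ≥ K, ∀ f : Ω → ℝ, Measurable[F k] f → (∃ b, ∀ ω, |f ω| ≤ b) →
    ∫ ω, f ω * D k ω ^ 2 ∂μ = ∫ ω, f ω * v k ω ∂μ

namespace VarianceIncrements

variable {Ω : Type*} [m0 : MeasurableSpace Ω] {μ : Measure Ω}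
  {F : Filtration ℕ m0} {β C c c' : ℝ} {K : ℕ} {D v : ℕ → Ω → ℝ}

lemma integral_mul_sq (h : VarianceIncrements μ F β C c c' K D v) {k : ℕ} (hk : K ≤ k)
    {w : Ω → ℝ} {b : ℝ} (hw : Measurable[F k] w) (hb : ∀ ω, |w ω| ≤ b)
    {f : Ω → ℝ} (hf : Measurable[F k] f) (hfb : ∃ b, ∀ ω, |f ω| ≤ b) :
    ∫ ω, f ω * (w ω * D k ω) ^ 2 ∂μ = ∫ ω, f ω * (w ω ^ 2 * v k ω) ∂μ := by
  obtain ⟨b', hb'⟩ := hfb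
  have := h.var k hk (fun ω => f ω * w ω ^ 2) (hf.mul (hw.pow_const 2)) ⟨b' * b ^ 2, fun ω => by
    rw [abs_mul, abs_pow]
    exact mul_le_mul (hb' ω) (pow_le_pow_left₀ (abs_nonneg _) (hb ω) 2) (by positivity)
      ((abs_nonneg _).trans (hb' ω))⟩
  calc _ = ∫ ω, f ω * w ω ^ 2 * D k ω ^ 2 ∂μ := by congr 1; ext ω; ring
    _ = _ := this
    _ = _ := by congr 1; ext ω; ring

/-- Multiplying the increments by bounded predictable weights. -/
lemma weighted [IsProbabilityMeasure μ] (h : VarianceIncrements μ F β C c c' K D v) (hβ : 0 < β) (hc : 0 < c) {A b : ℝ}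
    {w : ℕ → Ω → ℝ} (hw : ∀ k ≥ K, Measurable[F k] (w k)) (hb : ∀ k ≥ K, ∀ ω, |w k ω| ≤ b)
    (hA : ∀ k ≥ K, ∀ ω, w k ω ^ 2 * v k ω ≤ A * (tailVar β k - tailVar β (k + 1))) :
    TailIncrements μ F β A (b * C) K (fun k ω => w k ω * D k ω) where
  one_le := h.one_le
  meas k hk := ((hw k hk).mono (F.mono (Nat.le_succ k)) le_rfl).mul (h.meas k hk)
  bdd k hk ω := by
    rw [abs_mul, mul_assoc]
    exact mul_le_mul (hb k hk ω) (h.bdd k hk ω) (abs_nonneg _) ((abs_nonneg _).trans (hb k hk ω))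
  mean k hk f hf hfb := by
    obtain ⟨b', hb'⟩ := hfb
    have := h.mean k hk (fun ω => f ω * w k ω) (hf.mul (hw k hk)) ⟨b' * b, fun ω => by
      rw [abs_mul]
      exact mul_le_mul (hb' ω) (hb k hk ω) (abs_nonneg _) ((abs_nonneg _).trans (hb' ω))⟩
    rw [← this]
    congr 1; ext ω; ring
  var k hk f hf hfb h0 := by
    rw [h.integral_mul_sq hk (hw k hk) (hb k hk) hf hfb, ← integral_const_mul]
    obtain ⟨b', hb'⟩ := hfb
    have hψ := sub_pos.2 (tailVar_lt_tailVar hβ (h.one_le.trans hk))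
    have hle : ∀ ω, f ω * (w k ω ^ 2 * v k ω) ≤
        A * (tailVar β k - tailVar β (k + 1)) * f ω := fun ω => by
      rw [mul_comm]
      exact mul_le_mul_of_nonneg_right (hA k hk ω) (h0 ω)
    have hvpos : ∀ ω, 0 ≤ v k ω := fun ω =>
      (mul_nonneg hc.le hψ.le).trans (h.le_var k hk ω)
    have hi : Integrable f μ := integrable_of_abs_le (hf.mono (F.le _) le_rfl) hb'
    refine integral_mono_of_nonneg (ae_of_all _ fun ω => ?_) (hi.const_mul _) (ae_of_all _ hle)
    exact mul_nonneg (h0 ω) (mul_nonneg (sq_nonneg _) (hvpos ω))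

lemma ratio_bounds (h : VarianceIncrements μ F β C c c' K D v) (hβ : 0 < β) (hc : 0 < c) {k : ℕ} (hk : K ≤ k) (ω : Ω) :
    0 < v k ω ∧ 0 ≤ (tailVar β k - tailVar β (k + 1)) / v k ω ∧
      (tailVar β k - tailVar β (k + 1)) / v k ω ≤ 1 / c := by
  have hψ := sub_pos.2 (tailVar_lt_tailVar hβ (h.one_le.trans hk))
  have hv := (mul_pos hc hψ).trans_le (h.le_var k hk ω)
  refine ⟨hv, (div_pos hψ hv).le, ?_⟩
  rw [div_le_div_iff₀ hv hc]
  linarith [h.le_var k hk ω]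

/-- The weights turning the conditional variances into the increments of `tailVar β`. -/
def weight (β : ℝ) (v : ℕ → Ω → ℝ) (k : ℕ) (ω : Ω) : ℝ :=
  Real.sqrt ((tailVar β k - tailVar β (k + 1)) / v k ω)

lemma measurable_weight (h : VarianceIncrements μ F β C c c' K D v) {k : ℕ} (hk : K ≤ k) :
    Measurable[F k] (weight β v k) :=
  Real.continuous_sqrt.measurable.comp (measurable_const.div (h.measVar k hk))

lemma abs_weight_le (h : VarianceIncrements μ F β C c c' K D v) (hβ : 0 < β) (hc : 0 < c) {k : ℕ}
    (hk : K ≤ k) (ω : Ω) : |weight β v k ω| ≤ Real.sqrt (1 / c) := by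
  rw [weight, abs_of_nonneg (Real.sqrt_nonneg _)]
  exact Real.sqrt_le_sqrt (h.ratio_bounds hβ hc hk ω).2.2

lemma weight_sq_mul (h : VarianceIncrements μ F β C c c' K D v) (hβ : 0 < β) (hc : 0 < c) {k : ℕ}
    (hk : K ≤ k) (ω : Ω) :
    weight β v k ω ^ 2 * v k ω = tailVar β k - tailVar β (k + 1) := by
  obtain ⟨h1, h2, -⟩ := h.ratio_bounds hβ hc hk ω
  rw [weight, Real.sq_sqrt h2, div_mul_cancel₀ _ h1.ne']

/-- Replacing the weights by their limit changes the sums only negligibly. -/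
lemma ae_eventually_abs_sum_sub_le [IsProbabilityMeasure μ]
    (h : VarianceIncrements μ F β C c c' K D v) (hβ : 0 < β) (hc : 0 < c) {α : ℝ}
    (hlim : ∀ᵐ ω ∂μ, Tendsto (fun k => weight β v k ω) atTop (𝓝 α)) {η : ℝ} (hη : 0 < η) :
    ∀ᵐ ω ∂μ, ∀ᶠ n in atTop, ∀ N ≥ n,
      |∑ k ∈ Finset.Ico n N, (α - weight β v k ω) * D k ω| ≤ η * iterLogScale β n := by
  obtain ⟨ω₀⟩ : Nonempty Ω := nonempty_of_isProbabilityMeasure μ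
  have hc' : 0 < c' := by
    have hψ := sub_pos.2 (tailVar_lt_tailVar hβ h.one_le)
    have := (mul_pos hc hψ).trans_le ((h.le_var K le_rfl ω₀).trans (h.var_le K le_rfl ω₀))
    exact pos_of_mul_pos_left this hψ.le
  obtain ⟨δ, hδ⟩ : ∃ δ, δ = η / (2 * Real.sqrt c') := ⟨_, rfl⟩
  have hδ0 : 0 < δ := by rw [hδ]; positivity
  have hδη : δ ^ 2 * c' < η ^ 2 := by
    have : δ ^ 2 * c' = η ^ 2 / 4 := by
      rw [hδ, div_pow, mul_pow, Real.sq_sqrt hc'.le]; field_simp; norm_num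
    rw [this]; nlinarith
  let w : ℕ → Ω → ℝ := fun k ω =>
    if |α - weight β v k ω| ≤ δ then α - weight β v k ω else 0
  have hwm : ∀ k ≥ K, Measurable[F k] (w k) := fun k hk => by
    have hm : Measurable[F k] fun ω => α - weight β v k ω := measurable_const.sub (h.measurable_weight hk)
    refine Measurable.ite ?_ hm measurable_const
    have : Measurable[F k] fun ω => |α - weight β v k ω| :=
      continuous_abs.measurable.comp hm
    exact this measurableSet_Iic
  have hwb : ∀ k ω, |w k ω| ≤ δ := fun k ω => by
    simp only [w]
    split_ifs with h1
    · exact h1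
    · simpa using hδ0.le
  have hT : TailIncrements μ F β (δ ^ 2 * c') (δ * C) K (fun k ω => w k ω * D k ω) := by
    refine h.weighted hβ hc hwm (fun k _ => hwb k) fun k hk ω => ?_
    have hv := (h.ratio_bounds hβ hc hk ω).1.le
    rw [mul_assoc]
    refine mul_le_mul ?_ (h.var_le k hk ω) hv (sq_nonneg _)
    rw [← sq_abs]
    exact pow_le_pow_left₀ (abs_nonneg _) (hwb k ω) 2
  filter_upwards [hlim, hT.ae_eventually_abs_sum_le hβ (by positivity) hη hδη] with ω h1 h2
  have h3 : ∀ᶠ k in atTop, |α - weight β v k ω| ≤ δ := by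
    have := (h1.const_sub α).abs
    rw [sub_self, abs_zero] at this
    exact this.eventually_le_const hδ0
  obtain ⟨M, hM⟩ := eventually_atTop.1 h3
  filter_upwards [h2, eventually_ge_atTop M] with n hn hnM N hN
  refine le_trans (le_of_eq ?_) (hn N hN)
  congr 1
  refine Finset.sum_congr rfl fun k hk => ?_
  rw [Finset.mem_Ico] at hk
  simp only [w, hM k (by omega), if_true]

lemma ae_sum_bounds [IsProbabilityMeasure μ]
    (h : VarianceIncrements μ F β C c c' K D v) (hβ : 0 < β) (hc : 0 < c) {α : ℝ}
    (hlim : ∀ᵐ ω ∂μ, Tendsto (fun k => weight β v k ω) atTop (𝓝 α)) {η : ℝ} (hη : 0 < η)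
    (hη1 : η < 1) :
    ∀ᵐ ω ∂μ,
      (∀ᶠ n in atTop, ∀ N ≥ n,
        |α * ∑ k ∈ Finset.Ico n N, D k ω| ≤ (1 + 2 * η) * iterLogScale β n) ∧
      (∃ᶠ n in atTop, ∀ᶠ N in atTop,
        (1 - 2 * η) * iterLogScale β n ≤ α * ∑ k ∈ Finset.Ico n N, D k ω) ∧
      (∃ᶠ n in atTop, ∀ᶠ N in atTop,
        α * ∑ k ∈ Finset.Ico n N, D k ω ≤ -((1 - 2 * η) * iterLogScale β n)) := by
  have hT : TailIncrements μ F β 1 (Real.sqrt (1 / c) * C) K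
      (fun k ω => weight β v k ω * D k ω) :=
    h.weighted hβ hc (fun k hk => h.measurable_weight hk) (fun k hk => h.abs_weight_le hβ hc hk)
      fun k hk ω => by rw [h.weight_sq_mul hβ hc hk, one_mul]
  have hv : ∀ k ≥ K, ∀ f : Ω → ℝ, Measurable[F k] f → (∃ b, ∀ ω, |f ω| ≤ b) →
      ∫ ω, f ω * (weight β v k ω * D k ω) ^ 2 ∂μ =
        (tailVar β k - tailVar β (k + 1)) * ∫ ω, f ω ∂μ := fun k hk f hf hfb => by
    rw [h.integral_mul_sq hk (h.measurable_weight hk) (h.abs_weight_le hβ hc hk) hf hfb,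
      ← integral_const_mul]
    refine integral_congr_ae (ae_of_all _ fun ω => ?_)
    simp only
    rw [h.weight_sq_mul hβ hc hk, mul_comm]
  have hdec : ∀ ω n N, α * ∑ k ∈ Finset.Ico n N, D k ω =
      ∑ k ∈ Finset.Ico n N, weight β v k ω * D k ω +
        ∑ k ∈ Finset.Ico n N, (α - weight β v k ω) * D k ω := fun ω n N => by
    rw [← Finset.sum_add_distrib, Finset.mul_sum]
    exact Finset.sum_congr rfl fun k _ => by ring
  filter_upwards [h.ae_eventually_abs_sum_sub_le hβ hc hlim hη,
    hT.ae_eventually_abs_sum_le hβ one_pos (s := 1 + η) (by linarith) (by nlinarith),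
    hT.ae_frequently_le_sum hv hβ (s := 1 - η) (by linarith) (by linarith),
    hT.neg.ae_frequently_le_sum (fun k hk f hf hfb => by simpa only [neg_sq] using hv k hk f hf hfb)
      hβ (s := 1 - η) (by linarith) (by linarith)] with ω h1 h2 h3 h4
  refine ⟨?_, ?_, ?_⟩
  · filter_upwards [h1, h2] with n hn1 hn2 N hN
    rw [hdec]
    refine (abs_add_le _ _).trans ?_
    linarith [hn1 N hN, hn2 N hN]
  · refine (h3.and_eventually h1).mono ?_
    rintro n ⟨hn, hn1⟩
    filter_upwards [hn, eventually_ge_atTop n] with N hN hNn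
    rw [hdec]
    linarith [(abs_le.1 (hn1 N hNn)).1]
  · refine (h4.and_eventually h1).mono ?_
    rintro n ⟨hn, hn1⟩
    filter_upwards [hn, eventually_ge_atTop n] with N hN hNn
    rw [hdec]
    rw [Finset.sum_neg_distrib] at hN
    linarith [(abs_le.1 (hn1 N hNn)).2]

/-- The law of the iterated logarithm for the tail of a convergent martingale. -/
theorem ae_limsup_eq_and_liminf_eq [IsProbabilityMeasure μ]
    (h : VarianceIncrements μ F β C c c' K D v) (hβ : 0 < β) (hc : 0 < c) {α : ℝ}
    (hlim : ∀ᵐ ω ∂μ, Tendsto (fun k => weight β v k ω) atTop (𝓝 α))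
    {X : ℕ → Ω → ℝ} {X' : Ω → ℝ} (hX : ∀ k ω, X (k + 1) ω - X k ω = D k ω)
    (hX' : ∀ᵐ ω ∂μ, Tendsto (fun n => X n ω) atTop (𝓝 (X' ω))) :
    ∀ᵐ ω ∂μ,
      limsup (fun n : ℕ => α * (n : ℝ) ^ β * (X n ω - X' ω) /
        Real.sqrt (2 * Real.log (Real.log n))) atTop = 1 ∧
      liminf (fun n : ℕ => α * (n : ℝ) ^ β * (X n ω - X' ω) /
        Real.sqrt (2 * Real.log (Real.log n))) atTop = -1 := by
  have hall : ∀ᵐ ω ∂μ, ∀ i : ℕ, _ := ae_all_iff.2 fun i : ℕ =>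
    h.ae_sum_bounds hβ hc hlim (η := 1 / ((i : ℝ) + 2)) (by positivity)
      (by rw [div_lt_one (by positivity)]; linarith [(Nat.cast_nonneg i : (0 : ℝ) ≤ i)])
  filter_upwards [hall, hX'] with ω hω hXω
  have hsum : ∀ n N, n ≤ N → ∑ k ∈ Finset.Ico n N, D k ω = X N ω - X n ω := fun n N hN => by
    simp only [← hX]
    exact Finset.sum_Ico_sub (fun k => X k ω) hN
  have ht : ∀ n, Tendsto (fun N => α * ∑ k ∈ Finset.Ico n N, D k ω) atTop
      (𝓝 (α * (X' ω - X n ω))) := fun n => by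
    refine ((hXω.sub_const (X n ω)).const_mul α).congr' ?_
    filter_upwards [eventually_ge_atTop n] with N hN
    rw [hsum n N hN]
  have hpos : ∀ᶠ n : ℕ in atTop, 0 < Real.sqrt (2 * Real.log (Real.log n)) ∧
      α * (n : ℝ) ^ β * (X n ω - X' ω) =
        (n : ℝ) ^ β * -(α * (X' ω - X n ω)) ∧ 1 ≤ n ∧ 0 < (n : ℝ) ^ β := by
    filter_upwards [tendsto_log_log_natCast_atTop.eventually_gt_atTop 0, eventually_ge_atTop 1]
      with n hn h1
    exact ⟨Real.sqrt_pos.2 (by positivity), by ring, h1,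
      Real.rpow_pos_of_pos (by exact_mod_cast h1) _⟩
  have hη : ∀ η > 0, ∃ i : ℕ, 2 * (1 / ((i : ℝ) + 2)) ≤ η := fun η hη => by
    obtain ⟨i, hi⟩ := exists_nat_gt (2 / η)
    refine ⟨i, ?_⟩
    rw [mul_one_div, div_le_iff₀ (by positivity)]
    rw [div_lt_iff₀ hη] at hi
    nlinarith
  refine limsup_eq_and_liminf_eq (fun η hη' => ?_) (fun η hη' => ?_) (fun η hη' => ?_)
  · obtain ⟨i, hi⟩ := hη η hη'
    filter_upwards [(hω i).1, hpos] with n hn hp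
    obtain ⟨hp1, hp2, hp3, hp4⟩ := hp
    have := le_of_tendsto (ht n).abs ((eventually_ge_atTop n).mono hn)
    rw [abs_div, abs_of_pos hp1, div_le_iff₀ hp1, hp2, abs_mul, abs_neg, abs_of_pos hp4]
    have h1 := mul_le_mul_of_nonneg_left this hp4.le
    rw [← mul_assoc, mul_comm _ (1 + 2 * (1 / ((i : ℝ) + 2))), mul_assoc,
      rpow_mul_iterLogScale hp3] at h1
    exact h1.trans (mul_le_mul_of_nonneg_right (by linarith) hp1.le)
  · obtain ⟨i, hi⟩ := hη η hη'
    refine ((hω i).2.2.and_eventually hpos).mono ?_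
    rintro n ⟨hn, hp1, hp2, hp3, hp4⟩
    have := le_of_tendsto (ht n) hn
    rw [le_div_iff₀ hp1, hp2]
    have h1 := mul_le_mul_of_nonneg_left (neg_le_neg this) hp4.le
    rw [neg_neg, ← mul_assoc, mul_comm _ (1 - 2 * (1 / ((i : ℝ) + 2))), mul_assoc,
      rpow_mul_iterLogScale hp3] at h1
    exact le_trans (mul_le_mul_of_nonneg_right (by linarith) hp1.le) h1
  · obtain ⟨i, hi⟩ := hη η hη'
    refine ((hω i).2.1.and_eventually hpos).mono ?_
    rintro n ⟨hn, hp1, hp2, hp3, hp4⟩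
    have := ge_of_tendsto (ht n) hn
    rw [div_le_iff₀ hp1, hp2, mul_neg, neg_mul]
    have h1 := mul_le_mul_of_nonneg_left this hp4.le
    rw [← mul_assoc, mul_comm _ (1 - 2 * (1 / ((i : ℝ) + 2))), mul_assoc,
      rpow_mul_iterLogScale hp3] at h1
    exact neg_le_neg (le_trans (mul_le_mul_of_nonneg_right (by linarith) hp1.le) h1)

end VarianceIncrements

lemma sum_sampleProbM {m w b : ℕ} (h : m ≤ w + b) :
    ∑ r ∈ Finset.range (m + 1), sampleProbM m r w b = 1 := by
  have h0 : ((w + b).choose m : ℝ) ≠ 0 := by exact_mod_cast (Nat.choose_pos h).ne'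
  simp only [sampleProbM]
  rw [← Finset.sum_div, div_eq_one_iff_eq h0, Nat.add_choose_eq,
    Finset.Nat.sum_antidiagonal_eq_sum_range_succ_mk]
  push_cast
  rfl

lemma sum_mul_sampleProbM {m w b : ℕ} (h : m + 1 ≤ w + b) (φ : ℕ → ℝ) :
    ∑ r ∈ Finset.range (m + 2), r * φ r * sampleProbM (m + 1) r w b =
      (m + 1) * (w / (w + b : ℝ)) *
        ∑ r ∈ Finset.range (m + 1), φ (r + 1) * sampleProbM m r (w - 1) b := by
  rcases w with _ | w
  · rw [Finset.sum_range_succ']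
    simp [sampleProbM]
  have h0 : ((w + 1 + b).choose (m + 1) : ℝ) ≠ 0 := by exact_mod_cast (Nat.choose_pos h).ne'
  have h1 : ((w + b).choose m : ℝ) ≠ 0 := by
    exact_mod_cast (Nat.choose_pos (by omega : m ≤ w + b)).ne'
  have h2 : ((w + b + 1 : ℕ) : ℝ) * (w + b).choose m =
      (w + b + 1).choose (m + 1) * ((m + 1 : ℕ) : ℝ) := by
    exact_mod_cast Nat.add_one_mul_choose_eq (w + b) m
  have h3 : (w : ℝ) + 1 + b ≠ 0 := by positivity
  rw [Finset.sum_range_succ', Finset.mul_sum]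
  simp only [CharP.cast_eq_zero, zero_mul, add_zero]
  refine Finset.sum_congr rfl fun r _ => ?_
  have h4 : ((w + 1 : ℕ) : ℝ) * w.choose r = (w + 1).choose (r + 1) * ((r + 1 : ℕ) : ℝ) := by
    exact_mod_cast Nat.add_one_mul_choose_eq w r
  rw [show w + b + 1 = w + 1 + b by ring] at h2
  simp only [sampleProbM, Nat.add_sub_add_right, Nat.add_sub_cancel]
  push_cast at h2 h4 ⊢
  field_simp
  linear_combination φ (r + 1) * b.choose (m - r) * ((r + 1) * (w + 1).choose (r + 1) * h2 -
    (w + 1 + b).choose (m + 1) * (m + 1) * h4)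

lemma sum_sampleProbR {m w b : ℕ} (h : 1 ≤ w + b) :
    ∑ r ∈ Finset.range (m + 1), sampleProbR m r w b = 1 := by
  have h0 : (w : ℝ) + b ≠ 0 := by exact_mod_cast (by omega : w + b ≠ 0)
  simp only [sampleProbR]
  rw [← Finset.sum_div, div_eq_one_iff_eq (pow_ne_zero _ h0), add_pow]
  exact Finset.sum_congr rfl fun r _ => by ring

lemma sum_mul_sampleProbR {m w b : ℕ} (h : 1 ≤ w + b) (φ : ℕ → ℝ) :
    ∑ r ∈ Finset.range (m + 2), r * φ r * sampleProbR (m + 1) r w b =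
      (m + 1) * (w / (w + b : ℝ)) *
        ∑ r ∈ Finset.range (m + 1), φ (r + 1) * sampleProbR m r w b := by
  have h0 : (w : ℝ) + b ≠ 0 := by exact_mod_cast (by omega : w + b ≠ 0)
  rw [Finset.sum_range_succ', Finset.mul_sum]
  simp only [CharP.cast_eq_zero, zero_mul, add_zero]
  refine Finset.sum_congr rfl fun r _ => ?_
  have h4 : ((m + 1 : ℕ) : ℝ) * m.choose r = (m + 1).choose (r + 1) * ((r + 1 : ℕ) : ℝ) := by
    exact_mod_cast Nat.add_one_mul_choose_eq m r
  simp only [sampleProbR, Nat.add_sub_add_right]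
  push_cast at h4 ⊢
  field_simp
  linear_combination -(φ (r + 1) * b ^ (m - r) * w ^ (r + 1) * (w + b) ^ (m + 1)) * h4

/-- The distribution of the number of white balls in a sample, in either model. -/
def drawProb (mdlM : Bool) (m k w b : ℕ) : ℝ :=
  if mdlM then sampleProbM m k w b else sampleProbR m k w b

/-- The finite population correction to the variance of a sample. -/
def drawCorrection (mdlM : Bool) (m : ℕ) (T : ℝ) : ℝ :=
  if mdlM then (T - m) / (T - 1) else 1

lemma sum_drawProb {mdlM : Bool} {m w b : ℕ} (h : (if mdlM then m else 1) ≤ w + b) :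
    ∑ r ∈ Finset.range (m + 1), drawProb mdlM m r w b = 1 := by
  cases mdlM
  · exact sum_sampleProbR (by simpa using h)
  · exact sum_sampleProbM (by simpa using h)

lemma sum_mul_sampleProbM_eq {m w b : ℕ} (h : m ≤ w + b) :
    ∑ r ∈ Finset.range (m + 1), r * sampleProbM m r w b = m * (w / (w + b : ℝ)) := by
  rcases m with _ | m
  · simp
  have h1 := sum_mul_sampleProbM h fun _ => 1
  simp only [mul_one, one_mul] at h1
  rw [h1]
  rcases w with _ | w
  · simp
  · rw [sum_sampleProbM (by simp; omega)]
    push_cast; ring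

lemma sum_mul_sampleProbR_eq {m w b : ℕ} (h : 1 ≤ w + b) :
    ∑ r ∈ Finset.range (m + 1), r * sampleProbR m r w b = m * (w / (w + b : ℝ)) := by
  rcases m with _ | m
  · simp
  have h1 := sum_mul_sampleProbR (m := m) h fun _ => 1
  simp only [mul_one, one_mul] at h1
  rw [h1, sum_sampleProbR h]
  push_cast; ring

lemma sum_mul_drawProb {mdlM : Bool} {m w b : ℕ} (h : (if mdlM then m else 1) ≤ w + b) :
    ∑ r ∈ Finset.range (m + 1), r * drawProb mdlM m r w b = m * (w / (w + b : ℝ)) := by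
  cases mdlM
  · exact sum_mul_sampleProbR_eq (by simpa using h)
  · exact sum_mul_sampleProbM_eq (by simpa using h)

lemma sum_sq_mul_sampleProbM {m w b : ℕ} (hm : 1 ≤ m) (h : m < w + b) :
    ∑ r ∈ Finset.range (m + 1), (r : ℝ) ^ 2 * sampleProbM m r w b =
      m * (w / (w + b : ℝ)) * (1 + (m - 1) * ((w - 1) / (w + b - 1))) := by
  obtain ⟨m, rfl⟩ := Nat.exists_eq_add_of_le' hm
  have h1 := sum_mul_sampleProbM h.le fun r => (r : ℝ)
  simp only [← sq] at h1
  rw [h1]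
  rcases w with _ | w
  · simp
  · simp only [Nat.cast_add_one, add_mul, one_mul, Finset.sum_add_distrib]
    rw [sum_sampleProbM (by simp; omega), sum_mul_sampleProbM_eq (by simp; omega)]
    simp only [Nat.add_sub_cancel]
    ring

lemma sum_sq_mul_sampleProbR {m w b : ℕ} (hm : 1 ≤ m) (h : 1 ≤ w + b) :
    ∑ r ∈ Finset.range (m + 1), (r : ℝ) ^ 2 * sampleProbR m r w b =
      m * (w / (w + b : ℝ)) * (1 + (m - 1) * (w / (w + b : ℝ))) := by
  obtain ⟨m, rfl⟩ := Nat.exists_eq_add_of_le' hm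
  have h1 := sum_mul_sampleProbR (m := m) h fun r => (r : ℝ)
  simp only [← sq] at h1
  rw [h1]
  simp only [Nat.cast_add_one, add_mul, one_mul, Finset.sum_add_distrib]
  rw [sum_sampleProbR h, sum_mul_sampleProbR_eq h]
  ring

lemma sum_sub_sq_mul_drawProb {mdlM : Bool} {m w b : ℕ} (hm : 1 ≤ m) (h : m < w + b) :
    ∑ r ∈ Finset.range (m + 1), ((r : ℝ) - m * (w / (w + b : ℝ))) ^ 2 * drawProb mdlM m r w b =
      m * (w / (w + b : ℝ)) * (1 - w / (w + b : ℝ)) * drawCorrection mdlM m (w + b) := by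
  have hT : (1 : ℝ) < w + b := by exact_mod_cast (by omega : 1 < w + b)
  have hT0 : (w : ℝ) + b ≠ 0 := by positivity
  have hT1 : (w : ℝ) + b - 1 ≠ 0 := by linarith
  have hle : (if mdlM then m else 1) ≤ w + b := by split_ifs <;> omega
  have e : ∀ r ∈ Finset.range (m + 1),
      ((r : ℝ) - m * (w / (w + b : ℝ))) ^ 2 * drawProb mdlM m r w b =
        (r : ℝ) ^ 2 * drawProb mdlM m r w b +
          (-2 * (m * (w / (w + b : ℝ))) * (r * drawProb mdlM m r w b) +
            (m * (w / (w + b : ℝ))) ^ 2 * drawProb mdlM m r w b) := fun r _ => by ring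
  rw [Finset.sum_congr rfl e, Finset.sum_add_distrib, Finset.sum_add_distrib, ← Finset.mul_sum,
    ← Finset.mul_sum, sum_drawProb hle, sum_mul_drawProb hle]
  cases mdlM
  · have := sum_sq_mul_sampleProbR hm (by omega : 1 ≤ w + b)
    simp only [drawProb, drawCorrection, Bool.false_eq_true, if_false, this]
    ring
  · simp only [drawProb, drawCorrection, if_true, sum_sq_mul_sampleProbM hm h]
    field_simp
    ring

namespace UrnScheme

/-- The proportion of white balls. -/
def whiteRatio {Ω : Type*} (W B : ℕ → Ω → ℕ) (n : ℕ) (ω : Ω) : ℝ := (W n ω : ℝ) / ((W n ω : ℝ) + B n ω)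

lemma whiteRatio_mem {Ω : Type*} {W B : ℕ → Ω → ℕ} (n : ℕ) (ω : Ω) : 0 ≤ whiteRatio W B n ω ∧ whiteRatio W B n ω ≤ 1 := by
  rw [whiteRatio]
  refine ⟨by positivity, div_le_one_of_le₀ ?_ (by positivity)⟩
  linarith [(Nat.cast_nonneg (B n ω) : (0 : ℝ) ≤ B n ω)]

variable {Ω : Type*} [m0 : MeasurableSpace Ω] {μ : Measure Ω} {mdlM : Bool} {m : ℕ}
  {a b : ℕ → ℤ} {σ : ℤ} {W0 B0 : ℕ} {W B R : ℕ → Ω → ℕ} {F : Filtration ℕ m0}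

lemma add_eq (h : UrnScheme μ mdlM m a b σ W0 B0 W B R F) (n : ℕ) (ω : Ω) :
    (W n ω : ℤ) + B n ω = (W0 + B0 : ℕ) + σ * n := by
  induction n with
  | zero => simp [h.initW, h.initB]
  | succ n ih =>
    have := h.balanced (m - R (n + 1) ω) (Nat.sub_le _ _)
    rw [h.dynW, h.dynB]
    push_cast at ih ⊢
    linarith

lemma add_eq_real (h : UrnScheme μ mdlM m a b σ W0 B0 W B R F) (n : ℕ) (ω : Ω) :
    (W n ω : ℝ) + B n ω = (W0 + B0 : ℕ) + σ * n := by
  exact_mod_cast h.add_eq n ω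

lemma replacement_eq (h : UrnScheme μ mdlM m a b σ W0 B0 W B R F) (n : ℕ) (ω : Ω) :
    a (m - R (n + 1) ω) = R (n + 1) ω * (a (m - 1) - a m) + a m := by
  rw [h.affine _ (Nat.sub_le _ _), Nat.cast_sub (h.sampleLe n ω)]
  ring

lemma dynW_real (h : UrnScheme μ mdlM m a b σ W0 B0 W B R F) (n : ℕ) (ω : Ω) :
    (W (n + 1) ω : ℝ) = W n ω + (R (n + 1) ω * ((a (m - 1) : ℝ) - a m) + a m) := by
  have := h.dynW n ω
  rw [h.replacement_eq] at this
  exact_mod_cast this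

lemma b_zero_eq (h : UrnScheme μ mdlM m a b σ W0 B0 W B R F) :
    b 0 = σ - m * (a (m - 1) - a m) - a m := by
  have h1 := h.balanced 0 (Nat.zero_le _)
  have h2 := h.affine 0 (Nat.zero_le _)
  push_cast at h2
  linarith

lemma le_W (h : UrnScheme μ mdlM m a b σ W0 B0 W B R F) (ham : 1 ≤ a m)
    (ha : 0 ≤ a (m - 1) - a m) (n : ℕ) (ω : Ω) : n ≤ W n ω := by
  induction n with
  | zero => exact Nat.zero_le _
  | succ n ih =>
    have h1 := h.dynW n ω
    rw [h.replacement_eq] at h1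
    have h2 : (0 : ℤ) ≤ R (n + 1) ω * (a (m - 1) - a m) := mul_nonneg (Int.natCast_nonneg _) ha
    zify at ih ⊢
    linarith

lemma le_B (h : UrnScheme μ mdlM m a b σ W0 B0 W B R F) (hb : 1 ≤ b 0)
    (ha : 0 ≤ a (m - 1) - a m) (n : ℕ) (ω : Ω) : n ≤ B n ω := by
  induction n with
  | zero => exact Nat.zero_le _
  | succ n ih =>
    have h1 := h.dynB n ω
    have h2 := h.balanced (m - R (n + 1) ω) (Nat.sub_le _ _)
    rw [h.replacement_eq] at h2
    have h3 : (R (n + 1) ω : ℤ) * (a (m - 1) - a m) ≤ m * (a (m - 1) - a m) :=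
      mul_le_mul_of_nonneg_right (by exact_mod_cast h.sampleLe n ω) ha
    have h4 := h.b_zero_eq
    zify at ih ⊢
    linarith

lemma measurable_whiteRatio (h : UrnScheme μ mdlM m a b σ W0 B0 W B R F) (n : ℕ) :
    Measurable[F n] (whiteRatio W B n) := by
  have h1 : Measurable[F n] fun ω => (W n ω : ℝ) := measurable_from_nat.comp (h.measW n)
  have h2 : Measurable[F n] fun ω => (B n ω : ℝ) := measurable_from_nat.comp (h.measB n)
  exact h1.div (h1.add h2)

variable [IsProbabilityMeasure μ]

lemma integral_mul_indicator (h : UrnScheme μ mdlM m a b σ W0 B0 W B R F) {n k : ℕ} (hk : k ≤ m)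
    {f : Ω → ℝ} (hf : Measurable[F n] f) (hb : ∃ c, ∀ ω, |f ω| ≤ c) :
    Integrable (fun ω => f ω * ({ω | R (n + 1) ω = k}.indicator fun _ => (1 : ℝ)) ω) μ ∧
    Integrable (fun ω => f ω * drawProb mdlM m k (W n ω) (B n ω)) μ ∧
    ∫ ω, f ω * ({ω | R (n + 1) ω = k}.indicator fun _ => (1 : ℝ)) ω ∂μ =
      ∫ ω, f ω * drawProb mdlM m k (W n ω) (B n ω) ∂μ := by
  obtain ⟨c, hc⟩ := hb
  have hs : MeasurableSet {ω | R (n + 1) ω = k} :=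
    F.le _ _ (h.measR n (measurableSet_singleton k))
  have hi : Integrable ({ω | R (n + 1) ω = k}.indicator fun _ => (1 : ℝ)) μ :=
    (integrable_const _).indicator hs
  have hfm : Measurable f := hf.mono (F.le _) le_rfl
  have hfi : Integrable (f * {ω | R (n + 1) ω = k}.indicator fun _ => (1 : ℝ)) μ :=
    hi.bdd_mul (c := c) hfm.aestronglyMeasurable (ae_of_all _ hc)
  have hce := condExp_mul_of_stronglyMeasurable_left (m := F n) hf.stronglyMeasurable hfi hi
  have hae : μ[f * {ω | R (n + 1) ω = k}.indicator fun _ => (1 : ℝ) | F n] =ᵐ[μ]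
      fun ω => f ω * drawProb mdlM m k (W n ω) (B n ω) := by
    filter_upwards [hce, h.condLaw n k hk] with ω h1 h2
    rw [h1, Pi.mul_apply, h2]
    rfl
  refine ⟨hfi, integrable_condExp.congr hae, ?_⟩
  rw [← integral_congr_ae hae, integral_condExp]
  rfl

/-- Averaging over the next sample, given the past. -/
lemma integral_sample (h : UrnScheme μ mdlM m a b σ W0 B0 W B R F) {n : ℕ} {f : ℕ → Ω → ℝ}
    (hf : ∀ k ≤ m, Measurable[F n] (f k)) (hb : ∀ k ≤ m, ∃ c, ∀ ω, |f k ω| ≤ c) :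
    ∫ ω, f (R (n + 1) ω) ω ∂μ =
      ∫ ω, ∑ k ∈ Finset.range (m + 1), f k ω * drawProb mdlM m k (W n ω) (B n ω) ∂μ := by
  have hk : ∀ k ∈ Finset.range (m + 1), k ≤ m := fun k hk => by
    have := Finset.mem_range.1 hk; omega
  have he : ∀ ω, f (R (n + 1) ω) ω = ∑ k ∈ Finset.range (m + 1),
      f k ω * ({ω | R (n + 1) ω = k}.indicator fun _ => (1 : ℝ)) ω := fun ω => by
    rw [Finset.sum_eq_single (R (n + 1) ω)]
    · simp
    · intro k _ hne
      simp [hne.symm]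
    · intro hne
      exact absurd (Finset.mem_range.2 (Nat.lt_succ_of_le (h.sampleLe n ω))) hne
  simp only [he]
  rw [integral_finsetSum _ fun k hk' =>
      (h.integral_mul_indicator (hk k hk') (hf k (hk k hk')) (hb k (hk k hk'))).1,
    integral_finsetSum _ fun k hk' =>
      (h.integral_mul_indicator (hk k hk') (hf k (hk k hk')) (hb k (hk k hk'))).2.1]
  exact Finset.sum_congr rfl fun k hk' =>
    (h.integral_mul_indicator (hk k hk') (hf k (hk k hk')) (hb k (hk k hk'))).2.2

lemma integral_mul_sample (h : UrnScheme μ mdlM m a b σ W0 B0 W B R F) (n : ℕ) {f : Ω → ℝ}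
    (hf : Measurable[F n] f) (hb : ∃ c, ∀ ω, |f ω| ≤ c) :
    ∫ ω, f ω * R (n + 1) ω ∂μ = ∫ ω, f ω * (m * whiteRatio W B n ω) ∂μ := by
  obtain ⟨c, hc⟩ := hb
  rw [h.integral_sample (f := fun k ω => f ω * k) (fun k _ => hf.mul_const _)
    fun k _ => ⟨c * k, fun ω => by
      rw [abs_mul, Nat.abs_cast]; exact mul_le_mul_of_nonneg_right (hc ω) (Nat.cast_nonneg _)⟩]
  congr 1; ext ω
  rw [whiteRatio, ← sum_mul_drawProb (h.sampleFit n ω), Finset.mul_sum]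
  exact Finset.sum_congr rfl fun k _ => mul_assoc _ _ _

lemma integral_mul_sub_sample_sq (h : UrnScheme μ mdlM m a b σ W0 B0 W B R F) {n : ℕ}
    (hn : ∀ ω, m < W n ω + B n ω) {f : Ω → ℝ}
    (hf : Measurable[F n] f) (hb : ∃ c, ∀ ω, |f ω| ≤ c) :
    ∫ ω, f ω * (R (n + 1) ω - m * whiteRatio W B n ω) ^ 2 ∂μ =
      ∫ ω, f ω * (m * whiteRatio W B n ω * (1 - whiteRatio W B n ω) *
        drawCorrection mdlM m ((W0 + B0 : ℕ) + σ * n)) ∂μ := by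
  obtain ⟨c, hc⟩ := hb
  rw [h.integral_sample (f := fun k ω => f ω * (k - m * whiteRatio W B n ω) ^ 2)
    (fun k _ => hf.mul ((measurable_const.sub ((h.measurable_whiteRatio n).const_mul _)).pow_const 2))
    fun k hk => ⟨c * m ^ 2, fun ω => by
      rw [abs_mul, abs_pow]
      have h1 := whiteRatio_mem (W := W) (B := B) n ω
      have hk' : (k : ℝ) ≤ m := by exact_mod_cast hk
      have hm : (0 : ℝ) ≤ m := Nat.cast_nonneg _
      have hk0 : (0 : ℝ) ≤ k := Nat.cast_nonneg _
      refine mul_le_mul (hc ω) (pow_le_pow_left₀ (abs_nonneg _) (abs_le.2 ⟨?_, ?_⟩) 2)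
        (by positivity) ((abs_nonneg _).trans (hc ω))
      · nlinarith
      · nlinarith⟩]
  congr 1; ext ω
  rw [← h.add_eq_real n ω]
  rw [whiteRatio, ← sum_sub_sq_mul_drawProb h.hm (hn ω), Finset.mul_sum]
  exact Finset.sum_congr rfl fun k _ => mul_assoc _ _ _

end UrnScheme

lemma Gamma_natCast_succ_add {s : ℝ} (hs : 0 < s) (n : ℕ) :
    Real.Gamma ((n + 1 : ℕ) + s) = Real.Gamma s * ∏ j ∈ Finset.range (n + 1), (s + j) := by
  induction n with
  | zero => simp [add_comm 1 s, Real.Gamma_add_one hs.ne', mul_comm]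
  | succ n ih =>
    rw [Finset.prod_range_succ, ← mul_assoc, ← ih,
      show (((n + 1 + 1 : ℕ) : ℝ) + s) = ((n + 1 : ℕ) + s) + 1 by push_cast; ring,
      Real.Gamma_add_one (by positivity)]
    ring

lemma tendsto_Gamma_div_Gamma {s t : ℝ} (hs : 0 < s) (ht : 0 < t) :
    Tendsto (fun n : ℕ => Real.Gamma ((n + 1 : ℕ) + s) / Real.Gamma ((n + 1 : ℕ) + (s + t)) *
      (n : ℝ) ^ t) atTop (𝓝 1) := by
  have h1 := (Real.GammaSeq_tendsto_Gamma (s + t)).div (Real.GammaSeq_tendsto_Gamma s)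
    (Real.Gamma_pos_of_pos hs).ne'
  have h2 := h1.mul_const (Real.Gamma s / Real.Gamma (s + t))
  have hΓ := (Real.Gamma_pos_of_pos hs).ne'
  have hΓ' := (Real.Gamma_pos_of_pos (add_pos hs ht)).ne'
  rw [div_mul_div_cancel₀ hΓ, div_self hΓ'] at h2
  refine h2.congr' ?_
  filter_upwards [eventually_ge_atTop 1] with n hn
  have hn0 : (0 : ℝ) < n := by exact_mod_cast hn
  have hp : ∀ u : ℝ, 0 < u → ∏ j ∈ Finset.range (n + 1), (u + (j : ℝ)) ≠ 0 := fun u hu =>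
    Finset.prod_ne_zero_iff.2 fun j _ => by positivity
  have e1 := hp s hs
  have e2 := hp (s + t) (add_pos hs ht)
  have e3 := (Real.rpow_pos_of_pos hn0 s).ne'
  have e4 : (n.factorial : ℝ) ≠ 0 := by positivity
  rw [Gamma_natCast_succ_add hs, Gamma_natCast_succ_add (add_pos hs ht), Pi.div_apply,
    Real.GammaSeq, Real.GammaSeq, Real.rpow_add hn0]
  field_simp

lemma tendsto_tailVar_sub_mul {β : ℝ} :
    Tendsto (fun k : ℕ => (tailVar β k - tailVar β (k + 1)) * (k : ℝ) ^ (2 * β + 1)) atTop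
      (𝓝 (2 * β)) := by
  have hd : HasDerivAt (fun x : ℝ => x ^ (-(2 * β))) (-(2 * β)) 1 := by
    simpa using Real.hasDerivAt_rpow_const (x := 1) (p := -(2 * β)) (Or.inl one_ne_zero)
  have h1 := hd.tendsto_slope_zero
  have h2 : Tendsto (fun k : ℕ => ((k : ℝ))⁻¹) atTop (𝓝[≠] 0) :=
    tendsto_nhdsWithin_iff.2 ⟨tendsto_inv_atTop_nhds_zero_nat,
      (eventually_ge_atTop 1).mono fun k hk => by
        have : (k : ℝ) ≠ 0 := by exact_mod_cast (by omega : k ≠ 0)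
        simpa using this⟩
  have h3 := (h1.comp h2).neg
  rw [neg_neg] at h3
  refine h3.congr' ?_
  filter_upwards [eventually_ge_atTop 1] with k hk
  have hk0 : (0 : ℝ) < k := by exact_mod_cast hk
  have e : ((k + 1 : ℕ) : ℝ) = k * (1 + (k : ℝ)⁻¹) := by push_cast; field_simp
  have e3 := (Real.rpow_pos_of_pos hk0 (2 * β)).ne'
  simp only [Function.comp_apply, inv_inv, Real.one_rpow, smul_eq_mul, tailVar]
  rw [e, Real.mul_rpow hk0.le (by positivity), Real.rpow_add_one hk0.ne', Real.rpow_neg hk0.le]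
  field_simp
  ring

section urnG

variable {T0 : ℕ} {σ : ℤ} {Λ : ℝ}

lemma urnQ_pos (hT : 0 < T0) (hσ : 0 < σ) (hΛ : 0 < Λ) : 0 < urnQ T0 σ Λ := by
  have hσ' : (0 : ℝ) < σ := by exact_mod_cast hσ
  have hT' : (0 : ℝ) < T0 := by exact_mod_cast hT
  exact div_pos (Real.Gamma_pos_of_pos (by positivity)) (Real.Gamma_pos_of_pos (by positivity))

lemma urnG_pos (hT : 0 < T0) (hσ : 0 < σ) (hΛ : 0 < Λ) (n : ℕ) : 0 < urnG T0 σ Λ n := by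
  have hσ' : (0 : ℝ) < σ := by exact_mod_cast hσ
  have hT' : (0 : ℝ) < T0 := by exact_mod_cast hT
  exact div_pos (mul_pos (urnQ_pos hT hσ hΛ) (Real.Gamma_pos_of_pos (by positivity)))
    (Real.Gamma_pos_of_pos (by positivity))

lemma urnG_succ_mul (hT : 0 < T0) (hσ : 0 < σ) (hΛ : 0 < Λ) (n : ℕ) :
    urnG T0 σ Λ (n + 1) * (1 + Λ * σ / (T0 + σ * n)) = urnG T0 σ Λ n := by
  have hσ' : (0 : ℝ) < σ := by exact_mod_cast hσ
  have hT' : (0 : ℝ) < T0 := by exact_mod_cast hT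
  have h1 : 0 < (n : ℝ) + T0 / σ := by positivity
  have h2 : 0 < (n : ℝ) + T0 / σ + Λ := by positivity
  have h3 := (Real.Gamma_pos_of_pos h2).ne'
  have e : (1 + Λ * σ / (T0 + σ * n) : ℝ) = (n + T0 / σ + Λ) / (n + T0 / σ) := by
    field_simp
    ring
  rw [urnG, urnG, show ((n + 1 : ℕ) : ℝ) + T0 / σ = (n + T0 / σ) + 1 by push_cast; ring,
    show (n : ℝ) + T0 / σ + 1 + Λ = (n + T0 / σ + Λ) + 1 by ring, Real.Gamma_add_one h1.ne',
    Real.Gamma_add_one h2.ne', e]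
  generalize (n : ℝ) + T0 / σ + Λ = y at *
  generalize (n : ℝ) + T0 / σ = x at *
  field_simp

lemma tendsto_urnG_succ_mul_rpow (hT : 0 < T0) (hσ : 0 < σ) (hΛ : 0 < Λ) :
    Tendsto (fun n : ℕ => urnG T0 σ Λ (n + 1) * (n : ℝ) ^ Λ) atTop (𝓝 (urnQ T0 σ Λ)) := by
  have hσ' : (0 : ℝ) < σ := by exact_mod_cast hσ
  have hT' : (0 : ℝ) < T0 := by exact_mod_cast hT
  have h := (tendsto_Gamma_div_Gamma (div_pos hT' hσ') hΛ).const_mul (urnQ T0 σ Λ)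
  rw [mul_one] at h
  refine h.congr fun n => ?_
  rw [urnG, add_assoc]
  ring

lemma tendsto_urnG_mul_atTop (hT : 0 < T0) (hσ : 0 < σ) (hΛ : 0 < Λ) (hΛ1 : Λ < 1) :
    Tendsto (fun n : ℕ => urnG T0 σ Λ n * (T0 + σ * n)) atTop atTop := by
  have hσ' : (1 : ℝ) ≤ σ := by exact_mod_cast hσ
  rw [← tendsto_add_atTop_iff_nat 1]
  have h1 := (tendsto_urnG_succ_mul_rpow hT hσ hΛ).pos_mul_atTop (urnQ_pos hT hσ hΛ)
    ((tendsto_rpow_atTop (sub_pos.2 hΛ1)).comp tendsto_natCast_atTop_atTop)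
  refine tendsto_atTop_mono' _ ?_ h1
  filter_upwards [eventually_ge_atTop 1] with n hn
  have hn0 : (0 : ℝ) < n := by exact_mod_cast hn
  rw [Function.comp_apply, mul_assoc, ← Real.rpow_add hn0, add_sub_cancel, Real.rpow_one]
  refine mul_le_mul_of_nonneg_left ?_ (urnG_pos hT hσ hΛ _).le
  push_cast
  nlinarith [(Nat.cast_nonneg T0 : (0 : ℝ) ≤ T0)]

end urnG

lemma tendsto_drawCorrection {mdlM : Bool} {m T0 : ℕ} {σ : ℤ} (hσ : 0 < σ) :
    Tendsto (fun n : ℕ => drawCorrection mdlM m (T0 + σ * n)) atTop (𝓝 1) := by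
  cases mdlM
  · simp [drawCorrection]
  · have hσ' : (0 : ℝ) < σ := by exact_mod_cast hσ
    have hT : Tendsto (fun n : ℕ => (T0 : ℝ) + σ * n - 1) atTop atTop :=
      tendsto_atTop_add_const_right _ _ (tendsto_atTop_add_const_left _ _
        (tendsto_natCast_atTop_atTop.const_mul_atTop hσ'))
    have h : Tendsto (fun n : ℕ => 1 + (1 - m : ℝ) / ((T0 : ℝ) + σ * n - 1)) atTop (𝓝 (1 + 0)) :=
      tendsto_const_nhds.add (tendsto_const_nhds.div_atTop hT)
    rw [add_zero] at h
    refine h.congr' ?_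
    filter_upwards [hT.eventually_gt_atTop 0] with n hn
    simp only [drawCorrection, if_true]
    field_simp
    ring

namespace UrnScheme

variable {Ω : Type*} [m0 : MeasurableSpace Ω] {μ : Measure Ω} {mdlM : Bool} {m : ℕ}
  {a b : ℕ → ℤ} {σ : ℤ} {W0 B0 : ℕ} {W B R : ℕ → Ω → ℕ} {F : Filtration ℕ m0}

lemma urnIndex_mul (h : UrnScheme μ mdlM m a b σ W0 B0 W B R F) :
    urnIndex m a σ * σ = m * ((a (m - 1) : ℝ) - a m) := by
  have hσ : (σ : ℝ) ≠ 0 := by exact_mod_cast (by linarith [h.hσ] : (0 : ℤ) < σ).ne'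
  rw [urnIndex, div_mul_cancel₀ _ hσ]

lemma replacement_sub_pos (h : UrnScheme μ mdlM m a b σ W0 B0 W B R F)
    (hΛ : 0 < urnIndex m a σ) : 0 < (a (m - 1) : ℝ) - a m := by
  have hσ : (0 : ℝ) < σ := by exact_mod_cast (by linarith [h.hσ] : (0 : ℤ) < σ)
  have h1 := mul_pos hΛ hσ
  rw [h.urnIndex_mul] at h1
  exact pos_of_mul_pos_right h1 (Nat.cast_nonneg _)

lemma cast_b_zero (h : UrnScheme μ mdlM m a b σ W0 B0 W B R F) :
    (b 0 : ℝ) = σ * (1 - urnIndex m a σ) - a m := by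
  have := h.b_zero_eq
  have h1 : (b 0 : ℝ) = σ - m * ((a (m - 1) : ℝ) - a m) - a m := by exact_mod_cast this
  rw [h1, ← h.urnIndex_mul]
  ring

lemma total_pos (h : UrnScheme μ mdlM m a b σ W0 B0 W B R F) (ω : Ω) : 0 < W0 + B0 := by
  have h1 := h.sampleFit 0 ω
  rw [h.initW, h.initB] at h1
  have h2 := h.hm
  split_ifs at h1 <;> omega

lemma whiteRatio_eq (h : UrnScheme μ mdlM m a b σ W0 B0 W B R F) (n : ℕ) (ω : Ω) :
    whiteRatio W B n ω = (W n ω : ℝ) / ((W0 + B0 : ℕ) + σ * n) := by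
  rw [whiteRatio, h.add_eq_real]

lemma whiteRatio_bounds (h : UrnScheme μ mdlM m a b σ W0 B0 W B R F) (ham : 1 ≤ a m)
    (hb : 1 ≤ b 0) (ha : 0 ≤ a (m - 1) - a m) {n : ℕ} (hn : 1 ≤ n) (ω : Ω) :
    1 / ((W0 + B0 : ℕ) + σ : ℝ) ≤ whiteRatio W B n ω ∧
      1 / ((W0 + B0 : ℕ) + σ : ℝ) ≤ 1 - whiteRatio W B n ω := by
  have hW : (n : ℝ) ≤ W n ω := by exact_mod_cast h.le_W ham ha n ω
  have hB : (n : ℝ) ≤ B n ω := by exact_mod_cast h.le_B hb ha n ω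
  have hn' : (1 : ℝ) ≤ n := by exact_mod_cast hn
  have hσ : (1 : ℝ) ≤ σ := by exact_mod_cast h.hσ
  have hT := h.add_eq_real n ω
  have hT0 : (0 : ℝ) ≤ (W0 + B0 : ℕ) := Nat.cast_nonneg _
  have h0 : (0 : ℝ) < W n ω + B n ω := by linarith
  have h1 : (W n ω : ℝ) + B n ω ≤ n * ((W0 + B0 : ℕ) + σ) := by rw [hT]; nlinarith
  have e : 1 - whiteRatio W B n ω = B n ω / ((W n ω : ℝ) + B n ω) := by
    rw [whiteRatio]; field_simp; ring
  rw [e, whiteRatio, div_le_div_iff₀ (by linarith) h0, div_le_div_iff₀ (by linarith) h0]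
  have h2 : (0 : ℝ) ≤ (W0 + B0 : ℕ) + σ := by linarith
  constructor
  · nlinarith [mul_le_mul_of_nonneg_right hW h2]
  · nlinarith [mul_le_mul_of_nonneg_right hB h2]

variable [IsProbabilityMeasure μ]

lemma integrable_W (h : UrnScheme μ mdlM m a b σ W0 B0 W B R F) (n : ℕ) :
    Integrable (fun ω => (W n ω : ℝ)) μ := by
  refine Integrable.of_bound ((measurable_from_nat.comp
    ((h.measW n).mono (F.le n) le_rfl)).aestronglyMeasurable) ((W0 + B0 : ℕ) + σ * n)
    (ae_of_all _ fun ω => ?_)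
  rw [← h.add_eq_real n ω, Real.norm_of_nonneg (Nat.cast_nonneg _)]
  linarith [(Nat.cast_nonneg (B n ω) : (0 : ℝ) ≤ B n ω)]

lemma integrable_R (h : UrnScheme μ mdlM m a b σ W0 B0 W B R F) (n : ℕ) :
    Integrable (fun ω => (R (n + 1) ω : ℝ)) μ := by
  refine Integrable.of_bound ((measurable_from_nat.comp
    ((h.measR n).mono (F.le (n + 1)) le_rfl)).aestronglyMeasurable) m
    (ae_of_all _ fun ω => ?_)
  rw [Real.norm_of_nonneg (Nat.cast_nonneg _)]
  exact_mod_cast h.sampleLe n ω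

lemma integral_W_succ (h : UrnScheme μ mdlM m a b σ W0 B0 W B R F) (n : ℕ) :
    ∫ ω, (W (n + 1) ω : ℝ) ∂μ =
      (1 + urnIndex m a σ * σ / ((W0 + B0 : ℕ) + σ * n)) * ∫ ω, (W n ω : ℝ) ∂μ + a m := by
  have h1 : ∫ ω, (R (n + 1) ω : ℝ) ∂μ = m / ((W0 + B0 : ℕ) + σ * n) * ∫ ω, (W n ω : ℝ) ∂μ := by
    have h2 := h.integral_mul_sample n (f := fun _ => 1) measurable_const
      ⟨1, fun _ => by simp⟩
    simp only [one_mul] at h2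
    rw [h2, ← integral_const_mul]
    congr 1; ext ω
    rw [h.whiteRatio_eq]
    ring
  simp only [h.dynW_real]
  have h3 : Integrable (fun ω => (R (n + 1) ω : ℝ) * ((a (m - 1) : ℝ) - a m) + a m) μ :=
    ((h.integrable_R n).mul_const _).add (integrable_const _)
  rw [integral_add (h.integrable_W n) h3,
    integral_add ((h.integrable_R n).mul_const _) (integrable_const _), integral_mul_const, h1,
    h.urnIndex_mul]
  simp
  ring

lemma calW_succ_sub (h : UrnScheme μ mdlM m a b σ W0 B0 W B R F) (hΛ : 0 < urnIndex m a σ)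
    (n : ℕ) (ω : Ω) :
    calW μ σ (urnIndex m a σ) (W0 + B0) W (n + 1) ω - calW μ σ (urnIndex m a σ) (W0 + B0) W n ω =
      urnG (W0 + B0) σ (urnIndex m a σ) (n + 1) * ((a (m - 1) : ℝ) - a m) *
        (R (n + 1) ω - m * whiteRatio W B n ω) := by
  rw [calW, calW, h.integral_W_succ, h.dynW_real, h.whiteRatio_eq,
    ← urnG_succ_mul (h.total_pos ω) (by linarith [h.hσ]) hΛ n, h.urnIndex_mul]
  ring

/-- The normalised centring of the mean is conserved. -/
lemma urnG_mul_integral_sub (h : UrnScheme μ mdlM m a b σ W0 B0 W B R F)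
    (hT : 0 < W0 + B0) (hΛ : 0 < urnIndex m a σ) (hΛ1 : urnIndex m a σ < 1) (n : ℕ) :
    urnG (W0 + B0) σ (urnIndex m a σ) n *
        (∫ ω, (W n ω : ℝ) ∂μ - urnZeta m a σ * ((W0 + B0 : ℕ) + σ * n) / σ) =
      urnG (W0 + B0) σ (urnIndex m a σ) 0 *
        (∫ ω, (W 0 ω : ℝ) ∂μ - urnZeta m a σ * (W0 + B0 : ℕ) / σ) := by
  have hσ : (0 : ℝ) < σ := by exact_mod_cast (by linarith [h.hσ] : (0 : ℤ) < σ)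
  have hT' : (0 : ℝ) < (W0 + B0 : ℕ) := by exact_mod_cast hT
  induction n with
  | zero => simp
  | succ n ih =>
    have hz : (a m : ℝ) = urnZeta m a σ * (1 - urnIndex m a σ) := by
      rw [urnZeta, div_mul_cancel₀ _ (by linarith)]
    have hTn : ((W0 + B0 : ℕ) + σ * n : ℝ) ≠ 0 := by positivity
    rw [← ih, ← urnG_succ_mul hT (by linarith [h.hσ]) hΛ n, h.integral_W_succ, mul_assoc]
    congr 1
    rw [hz]
    push_cast at hTn ⊢
    field_simp
    ring

lemma tendsto_whiteRatio (h : UrnScheme μ mdlM m a b σ W0 B0 W B R F)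
    (hΛ : 0 < urnIndex m a σ) (hΛ1 : urnIndex m a σ < 1) {ω : Ω} {x : ℝ}
    (hx : Tendsto (fun n => calW μ σ (urnIndex m a σ) (W0 + B0) W n ω) atTop (𝓝 x)) :
    Tendsto (fun n => whiteRatio W B n ω) atTop (𝓝 (urnZeta m a σ / σ)) := by
  have hσ : (0 : ℤ) < σ := by linarith [h.hσ]
  have hT := h.total_pos ω
  have hσ' : (0 : ℝ) < σ := by exact_mod_cast hσ
  have hT' : (0 : ℝ) < (W0 + B0 : ℕ) := by exact_mod_cast hT
  have h1 := ((hx.add_const (urnG (W0 + B0) σ (urnIndex m a σ) 0 *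
        (∫ ω, (W 0 ω : ℝ) ∂μ - urnZeta m a σ * (W0 + B0 : ℕ) / σ))).div_atTop
    (tendsto_urnG_mul_atTop hT hσ hΛ hΛ1)).add_const (urnZeta m a σ / σ)
  rw [zero_add] at h1
  refine h1.congr fun n => ?_
  have hg := urnG_pos hT hσ hΛ n
  have hTn : (0 : ℝ) < (W0 + B0 : ℕ) + σ * n := by positivity
  rw [h.whiteRatio_eq, ← h.urnG_mul_integral_sub hT hΛ hΛ1 n, calW]
  field_simp
  ring

end UrnScheme

namespace UrnScheme

variable {Ω : Type*} [m0 : MeasurableSpace Ω] {μ : Measure Ω} {mdlM : Bool} {m : ℕ}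
  {a b : ℕ → ℤ} {σ : ℤ} {W0 B0 : ℕ} {W B R : ℕ → Ω → ℕ} {F : Filtration ℕ m0}

/-- The increments of the martingale `calW`. -/
def martDiff (μ : Measure Ω) (m : ℕ) (a : ℕ → ℤ) (σ : ℤ) (T0 : ℕ) (W : ℕ → Ω → ℕ) (k : ℕ)
    (ω : Ω) : ℝ :=
  calW μ σ (urnIndex m a σ) T0 W (k + 1) ω - calW μ σ (urnIndex m a σ) T0 W k ω

/-- The deterministic factor of the conditional variance of `martDiff`. -/
def varFactor (mdlM : Bool) (m : ℕ) (a : ℕ → ℤ) (σ : ℤ) (T0 : ℕ) (k : ℕ) : ℝ :=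
  (urnG T0 σ (urnIndex m a σ) (k + 1) * ((a (m - 1) : ℝ) - a m)) ^ 2 *
    (m * drawCorrection mdlM m (T0 + σ * k))

/-- The conditional variance of `martDiff`. -/
def condVar (mdlM : Bool) (m : ℕ) (a : ℕ → ℤ) (σ : ℤ) (T0 : ℕ) (W B : ℕ → Ω → ℕ) (k : ℕ)
    (ω : Ω) : ℝ :=
  varFactor mdlM m a σ T0 k * (whiteRatio W B k ω * (1 - whiteRatio W B k ω))

lemma tendsto_varFactor_div {T0 : ℕ} (hT : 0 < T0) (hσ : 0 < σ) (hΛ : 1 / 2 < urnIndex m a σ) :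
    Tendsto (fun k => varFactor mdlM m a σ T0 k /
        (tailVar (urnIndex m a σ - 1 / 2) k - tailVar (urnIndex m a σ - 1 / 2) (k + 1))) atTop
      (𝓝 ((urnQ T0 σ (urnIndex m a σ) * ((a (m - 1) : ℝ) - a m)) ^ 2 * m /
        (2 * urnIndex m a σ - 1))) := by
  have hΛ0 : 0 < urnIndex m a σ := by linarith
  have h1 := (((tendsto_urnG_succ_mul_rpow hT hσ hΛ0).mul_const
    ((a (m - 1) : ℝ) - a m)).pow 2).mul
      ((tendsto_drawCorrection (mdlM := mdlM) (m := m) (T0 := T0) hσ).const_mul (m : ℝ))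
  have h2 := h1.div (tendsto_tailVar_sub_mul (β := urnIndex m a σ - 1 / 2)) (by linarith)
  rw [mul_one, show 2 * (urnIndex m a σ - 1 / 2) = 2 * urnIndex m a σ - 1 by ring] at h2
  refine h2.congr' ?_
  filter_upwards [eventually_ge_atTop 1] with k hk
  have hk0 : (0 : ℝ) < k := by exact_mod_cast hk
  have e := (Real.rpow_pos_of_pos hk0 (urnIndex m a σ)).ne'
  rw [Pi.div_apply, sub_add_cancel, two_mul, Real.rpow_add hk0, varFactor]
  field_simp

lemma measurable_martDiff (h : UrnScheme μ mdlM m a b σ W0 B0 W B R F) (k : ℕ) :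
    Measurable[F (k + 1)] (martDiff μ m a σ (W0 + B0) W k) := by
  have h1 : ∀ n, Measurable[F n] (calW μ σ (urnIndex m a σ) (W0 + B0) W n) := fun n =>
    ((measurable_from_nat.comp (h.measW n)).sub_const _).const_mul _
  exact (h1 (k + 1)).sub ((h1 k).mono (F.mono (Nat.le_succ k)) le_rfl)

lemma measurable_condVar (h : UrnScheme μ mdlM m a b σ W0 B0 W B R F) (k : ℕ) :
    Measurable[F k] (condVar mdlM m a σ (W0 + B0) W B k) :=
  ((h.measurable_whiteRatio k).mul (measurable_const.sub (h.measurable_whiteRatio k))).const_mul _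

variable [IsProbabilityMeasure μ]

lemma integral_mul_martDiff (h : UrnScheme μ mdlM m a b σ W0 B0 W B R F)
    (hΛ : 0 < urnIndex m a σ) (k : ℕ) {f : Ω → ℝ} (hf : Measurable[F k] f)
    (hb : ∃ c, ∀ ω, |f ω| ≤ c) : ∫ ω, f ω * martDiff μ m a σ (W0 + B0) W k ω ∂μ = 0 := by
  obtain ⟨c, hc⟩ := hb
  have hfm : AEStronglyMeasurable f μ := (hf.mono (F.le k) le_rfl).aestronglyMeasurable
  have h1 : Integrable (fun ω => f ω * R (k + 1) ω) μ :=
    (h.integrable_R k).bdd_mul (c := c) hfm (ae_of_all _ hc)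
  have h2 : Integrable (fun ω => f ω * (m * whiteRatio W B k ω)) μ := by
    refine Integrable.bdd_mul (c := c) ?_ hfm (ae_of_all _ hc)
    refine Integrable.of_bound (((h.measurable_whiteRatio k).mono (F.le k) le_rfl).const_mul
      _).aestronglyMeasurable m (ae_of_all _ fun ω => ?_)
    have h3 := whiteRatio_mem (W := W) (B := B) k ω
    rw [Real.norm_of_nonneg (mul_nonneg (Nat.cast_nonneg _) h3.1)]
    exact mul_le_of_le_one_right (Nat.cast_nonneg _) h3.2
  calc ∫ ω, f ω * martDiff μ m a σ (W0 + B0) W k ω ∂μ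
      = ∫ ω, urnG (W0 + B0) σ (urnIndex m a σ) (k + 1) * ((a (m - 1) : ℝ) - a m) *
          (f ω * R (k + 1) ω - f ω * (m * whiteRatio W B k ω)) ∂μ := by
        congr 1; ext ω
        rw [martDiff, h.calW_succ_sub hΛ]
        ring
    _ = 0 := by
        rw [integral_const_mul, integral_sub h1 h2, h.integral_mul_sample k hf ⟨c, hc⟩, sub_self,
          mul_zero]

lemma integral_mul_martDiff_sq (h : UrnScheme μ mdlM m a b σ W0 B0 W B R F)
    (hΛ : 0 < urnIndex m a σ) {k : ℕ} (hk : m < k) {f : Ω → ℝ} (hf : Measurable[F k] f)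
    (hb : ∃ c, ∀ ω, |f ω| ≤ c) :
    ∫ ω, f ω * martDiff μ m a σ (W0 + B0) W k ω ^ 2 ∂μ =
      ∫ ω, f ω * condVar mdlM m a σ (W0 + B0) W B k ω ∂μ := by
  have hn : ∀ ω, m < W k ω + B k ω := fun ω => by
    have h1 := h.add_eq k ω
    have h2 : (k : ℤ) ≤ σ * k := le_mul_of_one_le_left (Int.natCast_nonneg _) h.hσ
    zify at hk ⊢
    linarith [Int.natCast_nonneg (W0 + B0)]
  have h1 := h.integral_mul_sub_sample_sq hn hf hb
  calc ∫ ω, f ω * martDiff μ m a σ (W0 + B0) W k ω ^ 2 ∂μ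
      = ∫ ω, (urnG (W0 + B0) σ (urnIndex m a σ) (k + 1) * ((a (m - 1) : ℝ) - a m)) ^ 2 *
          (f ω * (R (k + 1) ω - m * whiteRatio W B k ω) ^ 2) ∂μ := by
        congr 1; ext ω
        rw [martDiff, h.calW_succ_sub hΛ]
        ring
    _ = _ := by
        rw [integral_const_mul, h1, ← integral_const_mul]
        congr 1; ext ω
        rw [condVar, varFactor]
        ring

lemma exists_varianceIncrements (h : UrnScheme μ mdlM m a b σ W0 B0 W B R F)
    (ham : 1 ≤ a m) (hb : 1 ≤ b 0) (hΛ : 1 / 2 < urnIndex m a σ) :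
    ∃ C c c' K, 0 < c ∧ VarianceIncrements μ F (urnIndex m a σ - 1 / 2) C c c' K
      (martDiff μ m a σ (W0 + B0) W) (condVar mdlM m a σ (W0 + B0) W B) := by
  have hΩ : Nonempty Ω := nonempty_of_isProbabilityMeasure μ
  have hT := h.total_pos hΩ.some
  have hσ : (0 : ℤ) < σ := by linarith [h.hσ]
  have hΛ0 : 0 < urnIndex m a σ := by linarith
  have hκ := h.replacement_sub_pos hΛ0
  have hκ' : 0 ≤ a (m - 1) - a m := by exact_mod_cast hκ.le
  have hQ := urnQ_pos hT hσ hΛ0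
  have hm : (0 : ℝ) < m := by exact_mod_cast h.hm
  have hε : (0 : ℝ) < 1 / ((W0 + B0 : ℕ) + σ : ℝ) := by
    have : (0 : ℝ) < σ := by exact_mod_cast hσ
    positivity
  have hr := tendsto_varFactor_div (mdlM := mdlM) hT hσ hΛ
  set Q := urnQ (W0 + B0) σ (urnIndex m a σ) with hQdef
  set κ := (a (m - 1) : ℝ) - a m with hκdef
  set r := (Q * κ) ^ 2 * m / (2 * urnIndex m a σ - 1) with hrdef
  set ε := 1 / ((W0 + B0 : ℕ) + σ : ℝ) with hεdef
  have hr0 : 0 < r := div_pos (by positivity) (by linarith)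
  obtain ⟨K, hK⟩ := eventually_atTop.1 (((hr.eventually_const_le (half_lt_self hr0)).and
    (hr.eventually_le_const (by linarith : r < 2 * r))).and
    (((tendsto_urnG_succ_mul_rpow hT hσ hΛ0).eventually_le_const
      (by linarith : Q < 2 * Q)).and (eventually_gt_atTop m)))
  have h1m := h.hm
  have hmK : m < max K (m + 1) := lt_max_of_lt_right (Nat.lt_succ_self m)
  have hψ : ∀ k ≥ max K (m + 1), 0 < tailVar (urnIndex m a σ - 1 / 2) k -
      tailVar (urnIndex m a σ - 1 / 2) (k + 1) := fun k hk =>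
    sub_pos.2 (tailVar_lt_tailVar (by linarith) (by omega))
  have hp : ∀ k ≥ max K (m + 1), ∀ ω,
      ε * ε ≤ whiteRatio W B k ω * (1 - whiteRatio W B k ω) ∧
        whiteRatio W B k ω * (1 - whiteRatio W B k ω) ≤ 1 := fun k hk ω => by
    obtain ⟨h1, h2⟩ := h.whiteRatio_bounds ham hb hκ' (by omega : 1 ≤ k) ω
    exact ⟨mul_le_mul h1 h2 hε.le (hε.le.trans h1), by nlinarith⟩
  refine ⟨2 * Q * κ * m, r / 2 * (ε * ε), 2 * r, max K (m + 1), by positivity, ⟨by omega,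
    fun k _ => h.measurable_martDiff k, fun k hk ω => ?_,
    fun k _ f hf hfb => h.integral_mul_martDiff hΛ0 k hf hfb,
    fun k _ => h.measurable_condVar k, fun k hk ω => ?_, fun k hk ω => ?_,
    fun k hk f hf hfb => h.integral_mul_martDiff_sq hΛ0 (by omega) hf hfb⟩⟩
  · have hk0 : (0 : ℝ) < k := by exact_mod_cast (by omega : 0 < k)
    have h1 := (hK k (le_of_max_le_left hk)).2.1
    have hg := urnG_pos hT hσ hΛ0 (k + 1)
    have h2 : urnG (W0 + B0) σ (urnIndex m a σ) (k + 1) ≤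
        2 * Q * (k : ℝ) ^ (-urnIndex m a σ) := by
      rw [Real.rpow_neg hk0.le, ← div_eq_mul_inv, le_div_iff₀ (Real.rpow_pos_of_pos hk0 _)]
      exact h1
    have h3 := whiteRatio_mem (W := W) (B := B) k ω
    have h4 : (R (k + 1) ω : ℝ) ≤ m := by exact_mod_cast h.sampleLe k ω
    have h5 : |(R (k + 1) ω : ℝ) - m * whiteRatio W B k ω| ≤ m := abs_le.2
      ⟨by nlinarith [(Nat.cast_nonneg (R (k + 1) ω) : (0 : ℝ) ≤ R (k + 1) ω)], by nlinarith⟩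
    rw [martDiff, h.calW_succ_sub hΛ0, abs_mul, abs_of_pos (mul_pos hg hκ), add_sub_cancel]
    calc _ ≤ 2 * Q * (k : ℝ) ^ (-urnIndex m a σ) * κ * m := by gcongr
      _ = _ := by ring
  · have h1 := (hK k (le_of_max_le_left hk)).1.1
    rw [le_div_iff₀ (hψ k hk)] at h1
    have h2 := (hp k hk ω).1
    rw [condVar]
    calc _ = r / 2 * (tailVar (urnIndex m a σ - 1 / 2) k -
      tailVar (urnIndex m a σ - 1 / 2) (k + 1)) * (ε * ε) := by ring
      _ ≤ _ := mul_le_mul h1 h2 (by positivity)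
        ((mul_nonneg (by positivity) (hψ k hk).le).trans h1)
  · have h1 := (hK k (le_of_max_le_left hk)).1.2
    have h0 := (hK k (le_of_max_le_left hk)).1.1
    rw [le_div_iff₀ (hψ k hk)] at h0
    rw [div_le_iff₀ (hψ k hk)] at h1
    rw [condVar]
    exact (mul_le_of_le_one_right ((mul_nonneg (by positivity) (hψ k hk).le).trans h0)
      (hp k hk ω).2).trans h1

lemma tendsto_weight_condVar (h : UrnScheme μ mdlM m a b σ W0 B0 W B R F)
    (ham : 1 ≤ a m) (hb : 1 ≤ b 0) (hΛ : 1 / 2 < urnIndex m a σ) (hΛ1 : urnIndex m a σ < 1)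
    {ω : Ω} {x : ℝ}
    (hx : Tendsto (fun n => calW μ σ (urnIndex m a σ) (W0 + B0) W n ω) atTop (𝓝 x)) :
    Tendsto (fun k => VarianceIncrements.weight (urnIndex m a σ - 1 / 2)
      (condVar mdlM m a σ (W0 + B0) W B) k ω) atTop (𝓝 (alphaConst m a b σ (W0 + B0))) := by
  have hT := h.total_pos ω
  have hσ : (0 : ℤ) < σ := by linarith [h.hσ]
  have hσ' : (0 : ℝ) < σ := by exact_mod_cast hσ
  have hΛ0 : 0 < urnIndex m a σ := by linarith
  have hκ := h.replacement_sub_pos hΛ0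
  have hQ := urnQ_pos hT hσ hΛ0
  have hm : (0 : ℝ) < m := by exact_mod_cast h.hm
  have ha0 : (0 : ℝ) < a m := by exact_mod_cast (by linarith : 0 < a m)
  have hb0 : (0 : ℝ) < b 0 := by exact_mod_cast (by linarith : 0 < b 0)
  have hr := tendsto_varFactor_div (mdlM := mdlM) hT hσ hΛ
  have hw := h.tendsto_whiteRatio hΛ0 hΛ1 hx
  have hw2 := hr.mul (hw.mul (hw.const_sub 1))
  have hΛ' : 0 < 1 - urnIndex m a σ := by linarith
  have hΛ2 : 0 < 2 * urnIndex m a σ - 1 := by linarith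
  have e1 : 1 - urnZeta m a σ / σ = b 0 / (σ * (1 - urnIndex m a σ)) := by
    rw [h.cast_b_zero, urnZeta]
    field_simp
  have e2 : urnZeta m a σ / σ = a m / (σ * (1 - urnIndex m a σ)) := by
    rw [urnZeta]
    field_simp
  have e3 : (a (m - 1) : ℝ) - a m = urnIndex m a σ * σ / m := by
    rw [h.urnIndex_mul]
    field_simp
  have e4 : alphaConst m a b σ (W0 + B0) = Real.sqrt
      ((urnQ (W0 + B0) σ (urnIndex m a σ) * ((a (m - 1) : ℝ) - a m)) ^ 2 * m /
        (2 * urnIndex m a σ - 1) * (urnZeta m a σ / σ * (1 - urnZeta m a σ / σ)))⁻¹ := by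
    rw [alphaConst, ← Real.sqrt_sq (div_pos hΛ' (mul_pos hQ hΛ0)).le,
      ← Real.sqrt_mul (sq_nonneg _), e1, e2, e3]
    congr 1
    generalize urnIndex m a σ = Λ at *
    have h1 : 1 - Λ ≠ 0 := hΛ'.ne'
    have h2 : 2 * Λ - 1 ≠ 0 := hΛ2.ne'
    field_simp
  rw [e4]
  have hne : (urnQ (W0 + B0) σ (urnIndex m a σ) * ((a (m - 1) : ℝ) - a m)) ^ 2 * m /
        (2 * urnIndex m a σ - 1) * (urnZeta m a σ / σ * (1 - urnZeta m a σ / σ)) ≠ 0 := by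
    rw [e1, e2]
    positivity
  refine ((hw2.inv₀ hne).sqrt).congr fun k => ?_
  rw [VarianceIncrements.weight, condVar]
  congr 1
  rw [div_mul_eq_mul_div, inv_div]

end UrnScheme

/-- Law of the iterated logarithm for the martingale tail sum in
large-index urns. -/
theorem largeIndex_lil {Ω : Type*} [m0 : MeasurableSpace Ω] (μ : Measure Ω)
    [IsProbabilityMeasure μ] (mdlM : Bool) (m : ℕ) (a b : ℕ → ℤ) (σ : ℤ) (W0 B0 : ℕ)
    (W B : ℕ → Ω → ℕ) (R : ℕ → Ω → ℕ) (F : Filtration ℕ m0)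
    (hurn : UrnScheme μ mdlM m a b σ W0 B0 W B R F)
    (ham : 1 ≤ a m) (hb0 : 1 ≤ b 0)
    (hΛlo : 1 / 2 < urnIndex m a σ) (hΛhi : urnIndex m a σ < 1)
    (Winf : Ω → ℝ)
    (hWinf : ∀ᵐ ω ∂μ, Tendsto (fun n : ℕ => calW μ σ (urnIndex m a σ) (W0 + B0) W n ω)
      atTop (𝓝 (Winf ω))) :
    ∀ᵐ ω ∂μ,
      Filter.limsup (fun n : ℕ =>
          alphaConst m a b σ (W0 + B0) * (n : ℝ) ^ (urnIndex m a σ - 1 / 2) *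
            (calW μ σ (urnIndex m a σ) (W0 + B0) W n ω - Winf ω) /
          Real.sqrt (2 * Real.log (Real.log n))) atTop = 1 ∧
      Filter.liminf (fun n : ℕ =>
          alphaConst m a b σ (W0 + B0) * (n : ℝ) ^ (urnIndex m a σ - 1 / 2) *
            (calW μ σ (urnIndex m a σ) (W0 + B0) W n ω - Winf ω) /
          Real.sqrt (2 * Real.log (Real.log n))) atTop = -1 := by
  obtain ⟨C, c, c', K, hc, h⟩ := hurn.exists_varianceIncrements ham hb0 hΛlo
  refine h.ae_limsup_eq_and_liminf_eq (by linarith) hc ?_ (fun _ _ => rfl) hWinf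
  filter_upwards [hWinf] with ω hω
  exact hurn.tendsto_weight_condVar ham hb0 hΛlo hΛhi hω
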